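/- arXiv:1803.11297 — 13 statements merged into one kernel-verified Lean document; each statement's English description precedes it below -/
import Mathlib

section
/- Let R ⊂ S be a ring extension of length 2. Then exactly one of the following holds: (i) R ⊂ S is pointwise minimal, i.e., for every t ∈ S \ R the extension R ⊂ R[t] is minimal, where R[t] denotes the R-subalgebra of S generated by t; or (ii) R ⊂ S is simple, i.e., there exists x ∈ S with S = R[x]. -/
/-- `A ⊆ B` is a minimal extension of `R`-subalgebras of `S`. -/
def MinimalExt {R S : Type*} [CommRing R] [CommRing S] [Algebra R S]
    (A B : Subalgebra R S) : Prop :=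
  A < B ∧ ∀ C : Subalgebra R S, A < C → ¬ C < B

/-- The ring extension `R ⊂ S` has length 2. -/
def LengthTwo (R S : Type*) [CommRing R] [CommRing S] [Algebra R S] : Prop :=
  (∃ T : Subalgebra R S, ⊥ < T ∧ T < ⊤) ∧
    ¬ ∃ T₁ T₂ : Subalgebra R S, ⊥ < T₁ ∧ T₁ < T₂ ∧ T₂ < ⊤

theorem stmt_1 {R S : Type*} [CommRing R] [CommRing S] [Algebra R S]
    (hinj : Function.Injective (algebraMap R S))
    (hne : (⊥ : Subalgebra R S) ≠ ⊤)
    (hlen : LengthTwo R S) :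
    Xor'
      (∀ t : S, t ∉ (⊥ : Subalgebra R S) → MinimalExt ⊥ (Algebra.adjoin R {t}))
      (∃ x : S, Algebra.adjoin R {x} = ⊤) := by
  obtain ⟨⟨T, hT, hT'⟩, hchain⟩ := hlen
  have not_both : ¬ ((∀ t : S, t ∉ (⊥ : Subalgebra R S) →
      MinimalExt ⊥ (Algebra.adjoin R {t})) ∧ ∃ x : S, Algebra.adjoin R {x} = ⊤) := by
    rintro ⟨hmin, x, hx⟩
    have hxb : x ∉ (⊥ : Subalgebra R S) := fun hxb =>
      hne (top_le_iff.mp (hx ▸ Algebra.adjoin_le (Set.singleton_subset_iff.mpr hxb)))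
    exact (hmin x hxb).2 T hT (hx ▸ hT')
  by_cases hs : ∃ x : S, Algebra.adjoin R {x} = ⊤
  · exact Or.inr ⟨hs, fun h => not_both ⟨h, hs⟩⟩
  · refine Or.inl ⟨fun t ht => ⟨bot_lt_iff_ne_bot.mpr fun h => ht ?_, fun C hC hCt => ?_⟩, hs⟩
    · exact h ▸ Algebra.self_mem_adjoin_singleton R t
    · exact hchain ⟨C, _, hC, hCt, lt_top_iff_ne_top.mpr fun h => hs ⟨t, h⟩⟩
end

section
/- Let R ⊂ S be a ring extension of length 2. Then the support Supp_R(S/R) has at most two elements. -/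
open Polynomial

/-- `P` supports `B / A` iff some `x : B` has no multiple by an element outside `P` lying in the
image of `A`. -/
theorem mem_support_quotient_range_iff {A B : Type*} [CommRing A] [CommRing B] [Algebra A B]
    {P : PrimeSpectrum A} :
    P ∈ Module.support A (B ⧸ LinearMap.range (Algebra.linearMap A B)) ↔
      ∃ x : B, ∀ r ∉ P.asIdeal, r • x ∉ (⊥ : Subalgebra A B) := by
  rw [Module.mem_support_iff']
  constructor
  · rintro ⟨m, hm⟩
    obtain ⟨x, rfl⟩ := Submodule.Quotient.mk_surjective _ m
    refine ⟨x, fun r hr hx => hm r hr ?_⟩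
    rw [← Submodule.Quotient.mk_smul, Submodule.Quotient.mk_eq_zero]
    exact hx
  · rintro ⟨x, hx⟩
    refine ⟨Submodule.Quotient.mk x, fun r hr hm => hx r hr ?_⟩
    rw [← Submodule.Quotient.mk_smul, Submodule.Quotient.mk_eq_zero] at hm
    exact hm

section Minimal

variable {A B : Type*} [CommRing A] [CommRing B] [Algebra A B]

/-- The elements of `B` which lie in the image of `A` locally at `P`. -/
def locallyBot (B : Type*) [CommRing B] [Algebra A B] (P : PrimeSpectrum A) :
    Subalgebra A B where
  carrier := {b | ∃ r ∉ P.asIdeal, r • b ∈ (⊥ : Subalgebra A B)}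
  mul_mem' := by
    rintro x y ⟨r, hr, hx⟩ ⟨t, ht, hy⟩
    refine ⟨r * t, P.asIdeal.primeCompl.mul_mem hr ht, ?_⟩
    rw [← smul_mul_smul_comm]
    exact mul_mem hx hy
  add_mem' := by
    rintro x y ⟨r, hr, hx⟩ ⟨t, ht, hy⟩
    refine ⟨r * t, P.asIdeal.primeCompl.mul_mem hr ht, ?_⟩
    rw [smul_add, mul_smul, mul_smul, smul_comm r t x]
    exact add_mem (Subalgebra.smul_mem _ hx _) (Subalgebra.smul_mem _ hy _)
  algebraMap_mem' a := by
    refine ⟨1, P.asIdeal.primeCompl.one_mem, ?_⟩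
    rw [one_smul]
    exact Subalgebra.algebraMap_mem _ a

theorem mem_locallyBot {P : PrimeSpectrum A} {b : B} :
    b ∈ locallyBot B P ↔ ∃ r ∉ P.asIdeal, r • b ∈ (⊥ : Subalgebra A B) := Iff.rfl

theorem mem_support_iff_locallyBot_ne_top {P : PrimeSpectrum A} :
    P ∈ Module.support A (B ⧸ LinearMap.range (Algebra.linearMap A B)) ↔
      locallyBot B P ≠ ⊤ := by
  rw [mem_support_quotient_range_iff, ne_eq, Algebra.eq_top_iff]
  simp only [mem_locallyBot]
  push Not
  rfl

/-- The subalgebra `A + sB` of `B`. -/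
def botAddSMul (B : Type*) [CommRing B] [Algebra A B] (s : A) : Subalgebra A B where
  carrier := {b | ∃ (a : A) (c : B), b = algebraMap A B a + s • c}
  mul_mem' := by
    rintro _ _ ⟨a, c, rfl⟩ ⟨a', c', rfl⟩
    refine ⟨a * a', a • c' + a' • c + s • (c * c'), ?_⟩
    simp only [Algebra.smul_def, map_mul]
    ring
  add_mem' := by
    rintro _ _ ⟨a, c, rfl⟩ ⟨a', c', rfl⟩
    refine ⟨a + a', c + c', ?_⟩
    rw [map_add, smul_add]
    ring
  algebraMap_mem' a := ⟨a, 0, by simp⟩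

theorem mem_botAddSMul {s : A} {b : B} :
    b ∈ botAddSMul B s ↔ ∃ (a : A) (c : B), b = algebraMap A B a + s • c := Iff.rfl

/-- If `s` and all elements congruent to `1` modulo `s` act injectively on `B / A`, and `A` is
integrally closed in `B`, then any `b` congruent modulo `A` to an element of `s A[b]` is in `A`. -/
theorem mem_bot_of_sub_smul_aeval_mem_bot {s : A} {b : B}
    (hint : ∀ x : B, IsIntegral A x → x ∈ (⊥ : Subalgebra A B))
    (hs : ∀ x : B, s • x ∈ (⊥ : Subalgebra A B) → x ∈ (⊥ : Subalgebra A B))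
    (hone : ∀ (a : A) (x : B), (1 - s * a) • x ∈ (⊥ : Subalgebra A B) →
      x ∈ (⊥ : Subalgebra A B))
    (n : ℕ) (g : A[X]) (hg : g.natDegree ≤ n + 1)
    (h : b - s • aeval b g ∈ (⊥ : Subalgebra A B)) : b ∈ (⊥ : Subalgebra A B) := by
  induction n generalizing g with
  | zero =>
    rw [eq_X_add_C_of_natDegree_le_one hg] at h
    apply hone (g.coeff 1)
    have key : (1 - s * g.coeff 1) • b =
        (b - s • aeval b (C (g.coeff 1) * X + C (g.coeff 0))) +
          algebraMap A B (s * g.coeff 0) := by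
      simp only [map_add, map_mul, aeval_C, aeval_X, Algebra.smul_def, map_sub, map_one]
      ring
    rw [key]
    exact add_mem h (Subalgebra.algebraMap_mem _ _)
  | succ n ih =>
    obtain ⟨a, ha⟩ := Algebra.mem_bot.1 h
    set c := g.coeff (n + 2) with hc
    have hcb : c • b ∈ (⊥ : Subalgebra A B) := by
      apply hs
      set p : A[X] := C s * g + C a - X with hp
      have hpb : aeval b p = 0 := by
        simp only [hp, map_sub, map_add, map_mul, aeval_C, aeval_X, ha, Algebra.smul_def]
        ring
      have hpc : p.coeff (n + 2) = s * c := by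
        simp [hp, hc, coeff_X]
      have hdeg : p.natDegree ≤ n + 2 := by
        refine (natDegree_sub_le _ _).trans (max_le ((natDegree_add_le _ _).trans
          (max_le ((natDegree_C_mul_le _ _).trans hg) ?_)) (natDegree_X_le.trans (by omega)))
        simp
      rw [smul_smul, ← hpc]
      by_cases h0 : p.coeff (n + 2) = 0
      · rw [h0, zero_smul]
        exact zero_mem _
      · have := isIntegral_leadingCoeff_smul p b hpb
        rw [leadingCoeff, le_antisymm hdeg (le_natDegree_of_ne_zero h0)] at this
        exact hint _ this
    obtain ⟨d, hd⟩ := Algebra.mem_bot.1 hcb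
    have hlow : (g - C c * X ^ (n + 2)).natDegree ≤ n + 1 := by
      rw [natDegree_le_iff_coeff_eq_zero]
      intro N hN
      rw [coeff_sub, coeff_C_mul, coeff_X_pow]
      split_ifs with hN'
      · rw [hN', ← hc, mul_one, sub_self]
      · rw [coeff_eq_zero_of_natDegree_lt (by omega), mul_zero, sub_zero]
    refine ih (g - C c * X ^ (n + 2) + C d * X ^ (n + 1)) ?_ ?_
    · exact (natDegree_add_le _ _).trans (max_le hlow (natDegree_C_mul_X_pow_le _ _))
    · convert h using 3
      simp only [map_add, map_sub, map_mul, map_pow, aeval_C, aeval_X, hd, Algebra.smul_def]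
      ring

variable (hmin : ∀ C : Subalgebra A B, C = ⊥ ∨ C = ⊤)

include hmin

theorem mem_bot_of_smul_mem_bot {P : PrimeSpectrum A}
    (hP : P ∈ Module.support A (B ⧸ LinearMap.range (Algebra.linearMap A B)))
    {r : A} (hr : r ∉ P.asIdeal) {b : B} (hb : r • b ∈ (⊥ : Subalgebra A B)) :
    b ∈ (⊥ : Subalgebra A B) := by
  rw [← (hmin _).resolve_right (mem_support_iff_locallyBot_ne_top.1 hP)]
  exact ⟨r, hr, hb⟩

theorem bot_ne_top_of_mem_support {P : PrimeSpectrum A}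
    (hP : P ∈ Module.support A (B ⧸ LinearMap.range (Algebra.linearMap A B))) :
    (⊥ : Subalgebra A B) ≠ ⊤ := by
  have h := mem_support_iff_locallyBot_ne_top.1 hP
  rwa [(hmin _).resolve_right h] at h

/-- The primes supporting a minimal ring extension are contained in one another. -/
theorem asIdeal_le_of_mem_support {P Q : PrimeSpectrum A}
    (hP : P ∈ Module.support A (B ⧸ LinearMap.range (Algebra.linearMap A B)))
    (hQ : Q ∈ Module.support A (B ⧸ LinearMap.range (Algebra.linearMap A B))) :
    P.asIdeal ≤ Q.asIdeal := by
  intro s hsP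
  by_contra hsQ
  have hne := bot_ne_top_of_mem_support hmin hP
  have hs : ∀ x : B, s • x ∈ (⊥ : Subalgebra A B) → x ∈ (⊥ : Subalgebra A B) :=
    fun x => mem_bot_of_smul_mem_bot hmin hQ hsQ
  have hone : ∀ (a : A) (x : B), (1 - s * a) • x ∈ (⊥ : Subalgebra A B) →
      x ∈ (⊥ : Subalgebra A B) := by
    refine fun a x => mem_bot_of_smul_mem_bot hmin hP fun h => P.isPrime.one_notMem ?_
    simpa using add_mem h (P.asIdeal.mul_mem_right a hsP)
  obtain ⟨b, hb⟩ : ∃ b : B, b ∉ (⊥ : Subalgebra A B) := by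
    by_contra! h
    exact hne (Algebra.eq_top_iff.2 h)
  rcases hmin (integralClosure A B) with hcl | hcl
  · refine hb ?_
    have hgen : b ∈ Algebra.adjoin A {s • b} := by
      rcases hmin (Algebra.adjoin A {s • b}) with h | h
      · exact absurd (hs b (h ▸ Algebra.self_mem_adjoin_singleton A (s • b))) hb
      · rw [h]
        exact Algebra.mem_top
    rw [Algebra.adjoin_singleton_eq_range_aeval] at hgen
    obtain ⟨p, hp⟩ := hgen
    set q : A[X] := X * p.divX.comp (C s * X) with hq
    refine mem_bot_of_sub_smul_aeval_mem_bot (fun x hx => hcl ▸ hx) hs hone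
      q.natDegree q (Nat.le_succ _) ?_
    have key : b - s • aeval b q = algebraMap A B (p.coeff 0) := by
      have hp' : aeval (s • b) p = b := hp
      rw [← divX_mul_X_add p] at hp'
      simp only [map_add, map_mul, aeval_X, aeval_C] at hp'
      rw [sub_eq_iff_eq_add]
      conv_lhs => rw [← hp']
      simp only [hq, map_mul, aeval_X, aeval_comp, aeval_C, Algebra.smul_def]
      ring
    rw [key]
    exact Subalgebra.algebraMap_mem _ _
  · have htop : Algebra.adjoin A {b} = ⊤ :=
      (hmin _).resolve_left fun h => hb (h ▸ Algebra.self_mem_adjoin_singleton A b)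
    have hfin : Module.Finite A B := by
      have hbint : IsIntegral A b := by
        have : b ∈ integralClosure A B := hcl ▸ Algebra.mem_top
        exact this
      have := hbint.fg_adjoin_singleton
      rw [htop, Algebra.top_toSubmodule] at this
      exact ⟨this⟩
    have hsum : botAddSMul B s = ⊤ := by
      refine (hmin _).resolve_left fun h => hb (hs b ?_)
      rw [← h]
      exact ⟨0, b, by simp⟩
    obtain ⟨r, hr, hr0⟩ := Submodule.exists_sub_one_mem_and_smul_eq_zero_of_fg_of_le_smul
      (Ideal.span {s}) (⊤ : Submodule A (B ⧸ LinearMap.range (Algebra.linearMap A B)))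
      Module.Finite.fg_top (by
        intro m _
        obtain ⟨x, rfl⟩ := Submodule.Quotient.mk_surjective _ m
        have hx : x ∈ botAddSMul B s := hsum ▸ Algebra.mem_top
        obtain ⟨a, c, rfl⟩ := hx
        have h0 : (Submodule.Quotient.mk (algebraMap A B a) :
            B ⧸ LinearMap.range (Algebra.linearMap A B)) = 0 :=
          (Submodule.Quotient.mk_eq_zero _).2 ⟨a, rfl⟩
        rw [Submodule.Quotient.mk_add, h0, zero_add, Submodule.Quotient.mk_smul]
        exact Submodule.smul_mem_smul (Ideal.mem_span_singleton_self s) Submodule.mem_top)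
    refine hb (mem_bot_of_smul_mem_bot hmin hP (r := r) (fun h => P.isPrime.one_notMem ?_) ?_)
    · have hrP : r - 1 ∈ P.asIdeal := (Ideal.span_singleton_le_iff_mem _).2 hsP hr
      simpa using sub_mem h hrP
    · have := hr0 (Submodule.Quotient.mk b) Submodule.mem_top
      rw [← Submodule.Quotient.mk_smul, Submodule.Quotient.mk_eq_zero] at this
      exact this

/-- The support of a minimal ring extension has at most one element. -/
theorem support_subsingleton_of_minimal :
    (Module.support A (B ⧸ LinearMap.range (Algebra.linearMap A B))).Subsingleton :=
  fun _ hP _ hQ => PrimeSpectrum.ext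
    (le_antisymm (asIdeal_le_of_mem_support hmin hP hQ) (asIdeal_le_of_mem_support hmin hQ hP))

end Minimal

section Tower

variable {R S : Type*} [CommRing R] [CommRing S] [Algebra R S]

/-- A prime `P` of `R` at which `R` and `T` agree locally is the contraction of a prime of `T`;
if `P` supports `S / R`, this prime supports `S / T`. -/
theorem exists_mem_support_comap_eq (hinj : Function.Injective (algebraMap R S))
    (T : Subalgebra R S) {P : PrimeSpectrum R}
    (hS : P ∈ Module.support R (S ⧸ LinearMap.range (Algebra.linearMap R S)))
    (hT : P ∉ Module.support R (T ⧸ LinearMap.range (Algebra.linearMap R T))) :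
    ∃ Q ∈ Module.support T (S ⧸ LinearMap.range (Algebra.linearMap T S)),
      PrimeSpectrum.comap (algebraMap R T) Q = P := by
  have hinjT : Function.Injective (algebraMap R T) := fun x y h =>
    hinj (congrArg (Subtype.val : T → S) h)
  have hloc : ∀ t : T, ∃ r ∉ P.asIdeal, ∃ a, algebraMap R T a = r • t := by
    rw [mem_support_iff_locallyBot_ne_top, not_not, Algebra.eq_top_iff] at hT
    exact fun t => by simpa [mem_locallyBot, Algebra.mem_bot] using hT t
  let I : Ideal T :=
    { carrier := {t | ∃ r ∉ P.asIdeal, ∃ a ∈ P.asIdeal, algebraMap R T a = r • t}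
      add_mem' := by
        rintro x y ⟨r, hr, a, ha, hx⟩ ⟨r', hr', a', ha', hy⟩
        refine ⟨r * r', P.asIdeal.primeCompl.mul_mem hr hr', r' * a + r * a',
          add_mem (P.asIdeal.mul_mem_left _ ha) (P.asIdeal.mul_mem_left _ ha'), ?_⟩
        rw [map_add, map_mul, map_mul, hx, hy]
        simp only [Algebra.smul_def, map_mul]
        ring
      zero_mem' := ⟨1, P.asIdeal.primeCompl.one_mem, 0, zero_mem _, by simp⟩
      smul_mem' := by
        rintro t x ⟨r, hr, a, ha, hx⟩
        obtain ⟨r', hr', a', ht⟩ := hloc t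
        refine ⟨r' * r, P.asIdeal.primeCompl.mul_mem hr' hr, a' * a,
          P.asIdeal.mul_mem_left _ ha, ?_⟩
        rw [map_mul, ht, hx, smul_mul_smul_comm, smul_eq_mul] }
  have hmem : ∀ t : T, t ∈ I ↔
      ∃ r ∉ P.asIdeal, ∃ a ∈ P.asIdeal, algebraMap R T a = r • t := fun _ => Iff.rfl
  have hcomap : ∀ a : R, algebraMap R T a ∈ I ↔ a ∈ P.asIdeal := by
    intro a
    rw [hmem]
    constructor
    · rintro ⟨r, hr, c, hc, h⟩
      rw [Algebra.smul_def, ← map_mul] at h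
      exact (P.isPrime.mem_or_mem (hinjT h ▸ hc)).resolve_left hr
    · exact fun ha => ⟨1, P.asIdeal.primeCompl.one_mem, a, ha, (one_smul _ _).symm⟩
  have hnum : ∀ {t : T} {r a : R}, r ∉ P.asIdeal → algebraMap R T a = r • t →
      a ∈ P.asIdeal → t ∈ I := fun hr h ha => (hmem _).2 ⟨_, hr, _, ha, h⟩
  have hprime : I.IsPrime := by
    refine ⟨fun h => P.isPrime.one_notMem ((hcomap 1).1 (h ▸ Submodule.mem_top)), ?_⟩
    intro x y hxy
    obtain ⟨r, hr, a, hx⟩ := hloc x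
    obtain ⟨r', hr', a', hy⟩ := hloc y
    have haa : a * a' ∈ P.asIdeal := by
      rw [← hcomap, map_mul, hx, hy, smul_mul_smul_comm, Algebra.smul_def]
      exact I.mul_mem_left _ hxy
    exact (P.isPrime.mem_or_mem haa).imp (hnum hr hx) (hnum hr' hy)
  refine ⟨⟨I, hprime⟩, ?_, PrimeSpectrum.ext (Ideal.ext hcomap)⟩
  rw [mem_support_quotient_range_iff] at hS ⊢
  obtain ⟨x, hx⟩ := hS
  refine ⟨x, fun t ht htx => ?_⟩
  obtain ⟨u, hu⟩ := Algebra.mem_bot.1 htx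
  obtain ⟨r, hr, a, ha⟩ := hloc t
  obtain ⟨r', hr', a', ha'⟩ := hloc (r • u)
  have haP : a ∉ P.asIdeal := fun h => ht (hnum hr ha h)
  refine hx (r' * a) (P.asIdeal.primeCompl.mul_mem hr' haP) (Algebra.mem_bot.2 ⟨a', ?_⟩)
  have h1 : algebraMap R S a = r • (t : S) := congrArg (Subtype.val : T → S) ha
  have h2 : algebraMap R S a' = r' • r • (u : S) := congrArg (Subtype.val : T → S) ha'
  have h3 : (u : S) = (t : S) * x := hu
  rw [h2, h3, Algebra.smul_def (r' * a), map_mul, h1]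
  simp only [Algebra.smul_def]
  ring

theorem LengthTwo.exists_minimal (hlen : LengthTwo R S) :
    ∃ T : Subalgebra R S, (∀ C : Subalgebra R T, C = ⊥ ∨ C = ⊤) ∧
      ∀ C : Subalgebra T S, C = ⊥ ∨ C = ⊤ := by
  obtain ⟨⟨T, hT0, hT1⟩, hno⟩ := hlen
  refine ⟨T, fun C => ?_, fun C => ?_⟩
  · by_contra! hC
    have hinj : Function.Injective (Subalgebra.map T.val) :=
      Subalgebra.map_injective Subtype.val_injective
    refine hno ⟨C.map T.val, T, bot_lt_iff_ne_bot.2 fun h => hC.1 (hinj ?_),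
      lt_of_le_of_ne ?_ fun h => hC.2 (hinj ?_), hT1⟩
    · rw [h, Algebra.map_bot]
    · rintro _ ⟨y, -, rfl⟩
      exact y.2
    · rw [h, Algebra.map_top, Subalgebra.range_val]
  · by_contra! hC
    refine hno ⟨T, C.restrictScalars R, hT0, lt_of_le_of_ne ?_ fun h => hC.1 ?_,
      lt_top_iff_ne_top.2 fun h => hC.2 ?_⟩
    · exact fun x hx => C.algebraMap_mem ⟨x, hx⟩
    · refine le_bot_iff.1 fun x hx => ?_
      have hxT : x ∈ T := by
        rw [h]
        exact hx
      exact Algebra.mem_bot.2 ⟨⟨x, hxT⟩, rfl⟩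
    · refine Algebra.eq_top_iff.2 fun x => ?_
      have : x ∈ C.restrictScalars R := h ▸ Algebra.mem_top
      exact this

end Tower

theorem stmt_3 {R S : Type*} [CommRing R] [CommRing S] [Algebra R S]
    (hinj : Function.Injective (algebraMap R S))
    (hne : (⊥ : Subalgebra R S) ≠ ⊤)
    (hlen : LengthTwo R S) :
    ∃ p q : PrimeSpectrum R,
      Module.support R (S ⧸ LinearMap.range (Algebra.linearMap R S)) ⊆ {p, q} := by
  obtain ⟨T, hRT, hTS⟩ := hlen.exists_minimal
  have : Nontrivial R := by
    by_contra h
    rw [not_nontrivial_iff_subsingleton] at h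
    have := (algebraMap R S).codomain_trivial
    exact hne (Subsingleton.elim _ _)
  have hsub {s : Set (PrimeSpectrum R)} (hs : s.Subsingleton) : ∃ p, s ⊆ {p} := by
    obtain rfl | ⟨p, rfl⟩ := hs.eq_empty_or_singleton
    · exact ⟨Classical.arbitrary _, Set.empty_subset _⟩
    · exact ⟨p, subset_rfl⟩
  obtain ⟨p, hp⟩ := hsub (support_subsingleton_of_minimal hRT)
  obtain ⟨q, hq⟩ := hsub ((support_subsingleton_of_minimal hTS).image
    (PrimeSpectrum.comap (algebraMap R T)))
  refine ⟨p, q, fun P hP => ?_⟩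
  by_cases hPT : P ∈ Module.support R (T ⧸ LinearMap.range (Algebra.linearMap R T))
  · exact Or.inl (hp hPT)
  · exact Or.inr (hq (exists_mem_support_comap_eq hinj T hP hPT))
end

section
/- Let R ⊂ S be a ring extension such that Supp_R(S/R) = {M₁, M₂} where M₁ ≠ M₂ are maximal ideals of R. Then R ⊂ S has length 2 if and only if the number of R-subalgebras of S (including R and S) is exactly 4. Moreover, if these equivalent conditions hold, then S = R[x] for some x ∈ S. -/
section Lattice

variable {L : Type*} [Lattice L] [BoundedOrder L]

/-- If there is no chain `⊥ < s < t < ⊤`, then `p` and its complement `q` are the only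
elements strictly between `⊥` and `⊤`, as soon as every element splits along `p` and `q`. -/
theorem IsCompl.eq_of_no_chain {p q : L} (h : IsCompl p q) (hp : p ≠ ⊥) (hq : q ≠ ⊥)
    (hdec : ∀ t : L, t ≤ (t ⊓ p) ⊔ (t ⊓ q))
    (hchain : ¬ ∃ s t : L, ⊥ < s ∧ s < t ∧ t < ⊤) (t : L) :
    t = ⊥ ∨ t = p ∨ t = q ∨ t = ⊤ := by
  have atom : ∀ {r s : L}, IsCompl r s → s ≠ ⊥ → t ⊓ r = ⊥ ∨ t ⊓ r = r := by
    intro r s hrs hs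
    by_contra! hcon
    have hr : r ≠ ⊤ := fun hr => hs (by simpa [hr] using hrs.inf_eq_bot)
    exact hchain ⟨t ⊓ r, r, bot_lt_iff_ne_bot.2 hcon.1, lt_of_le_of_ne inf_le_right hcon.2,
      lt_top_iff_ne_top.2 hr⟩
  have ht : t = (t ⊓ p) ⊔ (t ⊓ q) := (hdec t).antisymm (sup_le inf_le_left inf_le_left)
  rcases atom h hq with h1 | h1 <;> rcases atom h.symm hp with h2 | h2 <;> rw [h1, h2] at ht
  · exact .inl (by simpa using ht)
  · exact .inr (.inr (.inl (by simpa using ht)))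
  · exact .inr (.inl (by simpa using ht))
  · exact .inr (.inr (.inr (by rw [ht, h.sup_eq_top])))

/-- Two complementary nontrivial elements give four distinct elements. -/
theorem IsCompl.ncard_eq_four {p q : L} (h : IsCompl p q) (hp : p ≠ ⊥) (hq : q ≠ ⊥) :
    ({⊥, p, q, ⊤} : Set L).ncard = 4 := by
  have hpt : p ≠ ⊤ := fun hr => hq (by simpa [hr] using h.inf_eq_bot)
  have hqt : q ≠ ⊤ := fun hr => hp (by simpa [hr] using h.inf_eq_bot)
  have hpq : p ≠ q := fun hr => hq (by simpa [hr] using h.inf_eq_bot)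
  have hbt : (⊥ : L) ≠ ⊤ := fun hr => hp (le_bot_iff.1 (hr ▸ le_top))
  rw [Set.ncard_insert_of_notMem, Set.ncard_insert_of_notMem, Set.ncard_pair hqt]
  · simp [hpq, hpt]
  · simp [hp.symm, hq.symm, hbt]

/-- If every element splits along the complementary nontrivial elements `p` and `q`, then
the lattice has length two if and only if it has exactly four elements. -/
theorem IsCompl.no_chain_iff_card_eq_four {p q : L} (h : IsCompl p q) (hp : p ≠ ⊥)
    (hq : q ≠ ⊥) (hdec : ∀ t : L, t ≤ (t ⊓ p) ⊔ (t ⊓ q)) :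
    ((∃ t : L, ⊥ < t ∧ t < ⊤) ∧ ¬ ∃ s t : L, ⊥ < s ∧ s < t ∧ t < ⊤) ↔ Nat.card L = 4 := by
  have h4 := h.ncard_eq_four hp hq
  constructor
  · rintro ⟨-, hchain⟩
    rw [← h4, ← Set.ncard_univ]
    congr 1
    symm
    exact Set.eq_univ_of_forall (h.eq_of_no_chain hp hq hdec hchain)
  · intro hcard
    have : Finite L := Nat.finite_of_card_ne_zero (by omega)
    have huniv : ({⊥, p, q, ⊤} : Set L) = Set.univ :=
      Set.eq_of_subset_of_ncard_le (Set.subset_univ _) (by rw [h4, Set.ncard_univ, hcard])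
    have hpt : p ≠ ⊤ := fun hr => hq (by simpa [hr] using h.inf_eq_bot)
    have hmid : ∀ t : L, ⊥ < t → t < ⊤ → t = p ∨ t = q := fun t h1 h2 => by
      have ht : t ∈ ({⊥, p, q, ⊤} : Set L) := huniv ▸ Set.mem_univ t
      simpa [h1.ne', h2.ne] using ht
    refine ⟨⟨p, bot_lt_iff_ne_bot.2 hp, lt_top_iff_ne_top.2 hpt⟩, ?_⟩
    rintro ⟨s, t, hs, hst, ht⟩
    rcases hmid s hs (hst.trans ht) with rfl | rfl <;>
      rcases hmid t (hs.trans hst) ht with rfl | rfl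
    · exact hst.ne rfl
    · exact hp (by simpa [inf_eq_left.2 hst.le] using h.inf_eq_bot)
    · exact hq (by simpa [inf_eq_right.2 hst.le] using h.inf_eq_bot)
    · exact hst.ne rfl

end Lattice

section PowerTorsion

variable {R : Type*} (S : Type*) [CommRing R] [CommRing S] [Algebra R S]

/-- The elements of `S` which some power of `a` multiplies into the image of `R`. -/
def powerTorsionSubalgebra (a : R) : Subalgebra R S where
  carrier := {s | ∃ n : ℕ, a ^ n • s ∈ (⊥ : Subalgebra R S)}
  mul_mem' := by
    rintro x y ⟨m, hm⟩ ⟨n, hn⟩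
    refine ⟨m + n, ?_⟩
    rw [pow_add, ← smul_mul_smul_comm]
    exact mul_mem hm hn
  add_mem' := by
    rintro x y ⟨m, hm⟩ ⟨n, hn⟩
    refine ⟨m + n, ?_⟩
    rw [smul_add]
    refine add_mem ?_ ?_
    · rw [add_comm, pow_add, mul_smul]
      exact Subalgebra.smul_mem _ hm _
    · rw [pow_add, mul_smul]
      exact Subalgebra.smul_mem _ hn _
  algebraMap_mem' r := ⟨0, Subalgebra.smul_mem _ (Subalgebra.algebraMap_mem _ r) _⟩

variable {S}

theorem mem_powerTorsionSubalgebra {a : R} {s : S} :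
    s ∈ powerTorsionSubalgebra S a ↔ ∃ n : ℕ, a ^ n • s ∈ (⊥ : Subalgebra R S) :=
  Iff.rfl

theorem disjoint_powerTorsionSubalgebra {a b : R} (hab : IsCoprime a b) :
    Disjoint (powerTorsionSubalgebra S a) (powerTorsionSubalgebra S b) := by
  rw [disjoint_iff_inf_le]
  rintro x ⟨⟨m, hm⟩, ⟨n, hn⟩⟩
  obtain ⟨u, v, huv⟩ := hab.pow (m := m) (n := n)
  rw [← one_smul R x, ← huv, add_smul, mul_smul, mul_smul]
  exact add_mem (Subalgebra.smul_mem _ hm _) (Subalgebra.smul_mem _ hn _)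

theorem le_inf_powerTorsionSubalgebra_sup {a b : R} (hab : IsCoprime a b)
    (htors : ∀ x : S, x ∈ powerTorsionSubalgebra S (a * b)) (T : Subalgebra R S) :
    T ≤ (T ⊓ powerTorsionSubalgebra S a) ⊔ (T ⊓ powerTorsionSubalgebra S b) := by
  intro x hx
  obtain ⟨n, hn⟩ := htors x
  rw [mul_pow] at hn
  obtain ⟨u, v, huv⟩ := hab.pow (m := n) (n := n)
  rw [← one_smul R x, ← huv, add_smul, add_comm]
  refine add_mem (Algebra.mem_sup_left ⟨T.smul_mem hx _, n, ?_⟩)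
    (Algebra.mem_sup_right ⟨T.smul_mem hx _, n, ?_⟩)
  · rw [smul_smul, mul_left_comm, mul_smul]
    exact Subalgebra.smul_mem _ hn _
  · rw [smul_smul, mul_left_comm, mul_comm (b ^ n), mul_smul]
    exact Subalgebra.smul_mem _ hn _

theorem mk_smul_eq_zero_iff_smul_mem_bot {r : R} {x : S} :
    r • (Submodule.Quotient.mk x : S ⧸ LinearMap.range (Algebra.linearMap R S)) = 0 ↔
      r • x ∈ (⊥ : Subalgebra R S) := by
  rw [← Submodule.Quotient.mk_smul, Submodule.Quotient.mk_eq_zero]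
  rfl

/-- An element lying in all primes of the support of `S / R` is nilpotent on each element. -/
theorem mem_powerTorsionSubalgebra_of_support {c : R}
    (hc : ∀ P ∈ Module.support R (S ⧸ LinearMap.range (Algebra.linearMap R S)),
      c ∈ P.asIdeal) (x : S) : x ∈ powerTorsionSubalgebra S c := by
  set m : S ⧸ LinearMap.range (Algebra.linearMap R S) := Submodule.Quotient.mk x
  suffices h : c ∈ (Submodule.annihilator (R ∙ m)).radical by
    obtain ⟨n, hn⟩ := h
    rw [Submodule.mem_annihilator_span_singleton] at hn
    exact ⟨n, mk_smul_eq_zero_iff_smul_mem_bot.1 hn⟩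
  rw [Ideal.radical_eq_sInf, Submodule.mem_sInf]
  rintro P ⟨hle, hP⟩
  exact hc ⟨P, hP⟩ (Module.mem_support_iff_exists_annihilator.2 ⟨m, hle⟩)

theorem powerTorsionSubalgebra_ne_top_of_mem_support {b : R} {P : PrimeSpectrum R}
    (hP : P ∈ Module.support R (S ⧸ LinearMap.range (Algebra.linearMap R S)))
    (hb : b ∉ P.asIdeal) : powerTorsionSubalgebra S b ≠ ⊤ := by
  intro htop
  obtain ⟨m, hm⟩ := Module.mem_support_iff_exists_annihilator.1 hP
  obtain ⟨x, rfl⟩ := Submodule.Quotient.mk_surjective _ m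
  obtain ⟨n, hn⟩ := mem_powerTorsionSubalgebra.1 (htop ▸ Algebra.mem_top : x ∈ _)
  refine hb (P.isPrime.mem_of_pow_mem n (hm ?_))
  rw [Submodule.mem_annihilator_span_singleton]
  exact mk_smul_eq_zero_iff_smul_mem_bot.2 hn

end PowerTorsion

/-- If the only subalgebras are `⊥`, `⊤` and two complementary ones, then `S` is generated by
one element. -/
theorem exists_adjoin_singleton_eq_top_of_isCompl {R S : Type*} [CommRing R] [CommRing S]
    [Algebra R S] {A B : Subalgebra R S} (h : IsCompl A B) (hA : A ≠ ⊥) (hB : B ≠ ⊥)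
    (hall : ∀ T : Subalgebra R S, T = ⊥ ∨ T = A ∨ T = B ∨ T = ⊤) :
    ∃ x : S, Algebra.adjoin R {x} = ⊤ := by
  obtain ⟨y, hyA, hy⟩ := SetLike.exists_of_lt (bot_lt_iff_ne_bot.2 hA)
  obtain ⟨z, hzB, hz⟩ := SetLike.exists_of_lt (bot_lt_iff_ne_bot.2 hB)
  have hAB : ∀ {w : S}, w ∈ A → w ∈ B → w ∈ (⊥ : Subalgebra R S) := fun h1 h2 =>
    h.inf_eq_bot ▸ (⟨h1, h2⟩ : _ ∈ A ⊓ B)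
  have hyz := Algebra.self_mem_adjoin_singleton R (y + z)
  have hnA : y + z ∉ A := fun hc => hz (hAB ((add_mem_cancel_left hyA).1 hc) hzB)
  have hnB : y + z ∉ B := fun hc => hy (hAB hyA ((add_mem_cancel_right hzB).1 hc))
  refine ⟨y + z, ?_⟩
  rcases hall (Algebra.adjoin R {y + z}) with h1 | h1 | h1 | h1
  · exact absurd ((bot_le : ⊥ ≤ A) (h1 ▸ hyz)) hnA
  · exact absurd (h1 ▸ hyz) hnA
  · exact absurd (h1 ▸ hyz) hnB
  · exact h1

theorem stmt_5 {R S : Type*} [CommRing R] [CommRing S] [Algebra R S]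
    (hinj : Function.Injective (algebraMap R S))
    (hne : (⊥ : Subalgebra R S) ≠ ⊤)
    (M₁ M₂ : Ideal R) (hM₁ : M₁.IsMaximal) (hM₂ : M₂.IsMaximal) (hMne : M₁ ≠ M₂)
    (hsupp : Module.support R (S ⧸ LinearMap.range (Algebra.linearMap R S)) =
      {⟨M₁, hM₁.isPrime⟩, ⟨M₂, hM₂.isPrime⟩}) :
    (LengthTwo R S ↔ Nat.card (Subalgebra R S) = 4) ∧
    (LengthTwo R S → ∃ x : S, Algebra.adjoin R {x} = ⊤) := by
  obtain ⟨a, ha, b, hb, hab⟩ :=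
    Submodule.mem_sup.1 ((Ideal.eq_top_iff_one _).1 (hM₁.coprime_of_ne hM₂ hMne))
  have hcop : IsCoprime a b := ⟨1, 1, by simpa using hab⟩
  have ha₂ : a ∉ M₂ := fun h => (Ideal.ne_top_iff_one _).1 hM₂.ne_top (hab ▸ add_mem h hb)
  have hb₁ : b ∉ M₁ := fun h => (Ideal.ne_top_iff_one _).1 hM₁.ne_top (hab ▸ add_mem ha h)
  have htors : ∀ x : S, x ∈ powerTorsionSubalgebra S (a * b) := by
    refine mem_powerTorsionSubalgebra_of_support fun P hP => ?_
    rw [hsupp] at hP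
    rcases hP with rfl | rfl
    · exact M₁.mul_mem_right _ ha
    · exact M₂.mul_mem_left _ hb
  have hdec := le_inf_powerTorsionSubalgebra_sup hcop htors
  have hcompl : IsCompl (powerTorsionSubalgebra S a) (powerTorsionSubalgebra S b) :=
    ⟨disjoint_powerTorsionSubalgebra hcop,
      codisjoint_iff_le_sup.2 (by simpa only [top_inf_eq] using hdec ⊤)⟩
  have hA : powerTorsionSubalgebra S a ≠ ⊥ := fun h =>
    powerTorsionSubalgebra_ne_top_of_mem_support (S := S) (by rw [hsupp]; exact .inl rfl) hb₁
      (by simpa [h] using hcompl.sup_eq_top)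
  have hB : powerTorsionSubalgebra S b ≠ ⊥ := fun h =>
    powerTorsionSubalgebra_ne_top_of_mem_support (S := S) (by rw [hsupp]; exact .inr rfl) ha₂
      (by simpa [h] using hcompl.sup_eq_top)
  exact ⟨hcompl.no_chain_iff_card_eq_four hA hB hdec, fun hlen =>
    exists_adjoin_singleton_eq_top_of_isCompl hcompl hA hB
      (hcompl.eq_of_no_chain hA hB hdec hlen.2)⟩
end

section
/- Let R ⊂ S be a ring extension such that S is not integral over R and Supp_R(S/R) = {M} for a maximal ideal M of R, and let R̄ denote the integral closure of R in S. Then the following are equivalent: (1) R ⊂ S has length 2; (2) both R ⊂ R̄ and R̄ ⊂ S are minimal extensions; (3) the number of R-subalgebras of S (including R and S) is exactly 3. If these conditions hold, then S = R[x] for some x ∈ S. -/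
section

open Polynomial

/-- If `A` is integrally closed in `S`, a root `t` of a polynomial over `A` satisfies a
Prüfer-type relation whose right-hand side is the linear coefficient. -/
lemma IsIntegrallyClosedIn.exists_relation_of_aeval_eq_zero {A S : Type*} [CommRing A] [CommRing S]
    [Algebra A S] [IsIntegrallyClosedIn A S] (t : S) (p : A[X]) (hp : aeval t p = 0) :
    ∃ a b c : A, algebraMap A S a * t = algebraMap A S c ∧
      algebraMap A S a + algebraMap A S b * t = algebraMap A S (p.coeff 1) := by
  induction hn : p.natDegree using Nat.strong_induction_on generalizing p with
  | _ n ih =>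
  obtain ⟨β, hβ⟩ := IsIntegrallyClosedIn.algebraMap_eq_of_integral
    (isIntegral_leadingCoeff_smul p t hp)
  rw [Algebra.smul_def, leadingCoeff, hn] at hβ
  rcases n with _ | _ | _ | n
  · exact ⟨0, 0, 0, by simp, by simp [coeff_eq_zero_of_natDegree_lt (p := p) (n := 1) (by omega)]⟩
  · exact ⟨p.coeff 1, 0, β, hβ.symm, by simp⟩
  · rw [aeval_eq_sum_range, hn] at hp
    simp only [Finset.sum_range_succ, Finset.sum_range_zero, Algebra.smul_def] at hp
    refine ⟨β + p.coeff 1, - p.coeff 2, - p.coeff 0, ?_, ?_⟩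
    · simp only [map_add, map_neg, hβ]
      linear_combination hp
    · simp only [map_add, map_neg, hβ]
      ring
  · have hq : aeval t (p.eraseLead + C β * X ^ (n + 2)) = 0 := by
      rw [← p.eraseLead_add_C_mul_X_pow, hn, leadingCoeff, hn] at hp
      simp only [map_add, map_mul, aeval_C, aeval_X, map_pow, hβ] at hp ⊢
      linear_combination hp
    have hdeg : (p.eraseLead + C β * X ^ (n + 2)).natDegree < n + 3 := by
      refine Nat.lt_succ_of_le ((natDegree_add_le _ _).trans
        (max_le ?_ (natDegree_C_mul_X_pow_le _ _)))
      have := p.eraseLead_natDegree_le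
      omega
    obtain ⟨a, b, c, h₁, h₂⟩ := ih _ hdeg _ hq rfl
    refine ⟨a, b, c, h₁, h₂.trans ?_⟩
    rw [coeff_add, eraseLead_coeff_of_ne _ (by omega)]
    simp

/-- If `A` is integrally closed in `S`, an element that is a polynomial over `A` in its own square
satisfies a Prüfer-type relation. -/
lemma IsIntegrallyClosedIn.exists_relation_of_mem_adjoin_sq {A S : Type*} [CommRing A]
    [CommRing S] [Algebra A S] [IsIntegrallyClosedIn A S] {t : S}
    (ht : t ∈ Algebra.adjoin A {t ^ 2}) :
    ∃ a b c : A, algebraMap A S a * t = algebraMap A S c ∧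
      algebraMap A S a + algebraMap A S b * t = 1 := by
  rw [Algebra.adjoin_singleton_eq_range_aeval] at ht
  obtain ⟨q, hq⟩ := ht
  have hp : aeval t (X - expand A 2 q) = 0 := by
    simpa [expand_aeval, sub_eq_zero] using hq.symm
  have h1 : (X - expand A 2 q).coeff 1 = 1 := by
    simp [coeff_expand two_pos]
  simpa [h1] using exists_relation_of_aeval_eq_zero t _ hp

end

section

variable {R S : Type*} [CommRing R] [CommRing S] [Algebra R S]

lemma Subalgebra.mem_adjoin_of_mem_sup {B : Subalgebra R S} {x y : S}
    (h : y ∈ B ⊔ Algebra.adjoin R {x}) : y ∈ Algebra.adjoin B {x} := by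
  have hle : B ⊔ Algebra.adjoin R {x} ≤ (Algebra.adjoin B {x}).restrictScalars R :=
    sup_le (fun b hb ↦ (Algebra.adjoin B {x}).algebraMap_mem ⟨b, hb⟩)
      (Algebra.adjoin_le (by simp))
  exact hle h

/-- The ideal of all `r : R` such that `r • s` lies in the image of `R`. -/
def denominatorIdeal (R : Type*) {S : Type*} [CommRing R] [CommRing S] [Algebra R S] (s : S) :
    Ideal R :=
  (Subalgebra.toSubmodule (⊥ : Subalgebra R S)).comap (LinearMap.toSpanSingleton R S s)

lemma mem_denominatorIdeal {r : R} {s : S} :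
    r ∈ denominatorIdeal R s ↔ algebraMap R S r * s ∈ (⊥ : Subalgebra R S) := by
  simp [denominatorIdeal, Algebra.smul_def]

/-- `M` is the only prime containing a denominator ideal: `Supp_R (S / R) ⊆ {M}`. -/
def DenominatorPrimesEq (S : Type*) [CommRing S] [Algebra R S] (M : Ideal R) : Prop :=
  ∀ (s : S) (P : Ideal R), P.IsPrime → denominatorIdeal R s ≤ P → P = M

lemma denominatorPrimesEq_of_support {M : Ideal R} (hM : M.IsPrime)
    (hsupp : Module.support R (S ⧸ LinearMap.range (Algebra.linearMap R S)) = {⟨M, hM⟩}) :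
    DenominatorPrimesEq S M := by
  intro s P hP hs
  have : (⟨P, hP⟩ : PrimeSpectrum R) ∈
      Module.support R (S ⧸ LinearMap.range (Algebra.linearMap R S)) := by
    refine Module.mem_support_iff_exists_annihilator.2 ⟨Submodule.Quotient.mk s, fun r hr ↦ hs ?_⟩
    rw [Submodule.mem_annihilator_span_singleton, ← Submodule.Quotient.mk_smul,
      Submodule.Quotient.mk_eq_zero, Algebra.smul_def] at hr
    exact mem_denominatorIdeal.2 hr
  rw [hsupp] at this
  exact congrArg PrimeSpectrum.asIdeal this

variable {M : Ideal R}

lemma DenominatorPrimesEq.sup_span_eq_top (h : DenominatorPrimesEq S M) (s : S) {r : R}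
    (hr : r ∉ M) : denominatorIdeal R s ⊔ Ideal.span {r} = ⊤ := by
  by_contra hne
  obtain ⟨P, hP, hle⟩ := Ideal.exists_le_maximal _ hne
  obtain rfl := h s P hP.isPrime (le_sup_left.trans hle)
  exact hr (hle (le_sup_right (a := denominatorIdeal R s) (Ideal.mem_span_singleton_self r)))

lemma DenominatorPrimesEq.mem_of_mul_mem (h : DenominatorPrimesEq S M) {T : Subalgebra R S}
    {s : S} {r : R} (hr : r ∉ M) (hrs : algebraMap R S r * s ∈ T) : s ∈ T := by
  have h1 : (1 : R) ∈ denominatorIdeal R s ⊔ Ideal.span {r} := by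
    rw [h.sup_span_eq_top s hr]; trivial
  obtain ⟨y, hy, z, hz, hyz⟩ := Submodule.mem_sup.1 h1
  obtain ⟨x, rfl⟩ := Ideal.mem_span_singleton'.1 hz
  have hs : s = algebraMap R S y * s + algebraMap R S x * (algebraMap R S r * s) := by
    have := congrArg (algebraMap R S) hyz
    simp only [map_add, map_mul, map_one] at this
    linear_combination -s * this
  rw [hs]
  exact add_mem ((bot_le : ⊥ ≤ T) (mem_denominatorIdeal.1 hy))
    (mul_mem (T.algebraMap_mem x) hrs)

lemma DenominatorPrimesEq.exists_pow_mul_mem (h : DenominatorPrimesEq S M) (s : S) {m : R}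
    (hm : m ∈ M) : ∃ k : ℕ, algebraMap R S (m ^ k) * s ∈ (⊥ : Subalgebra R S) := by
  by_contra! hk
  obtain ⟨P, hP, hle, hdisj⟩ := Ideal.exists_le_prime_disjoint (denominatorIdeal R s)
    (Submonoid.powers m) (by
      rw [Set.disjoint_right]
      rintro _ ⟨k, rfl⟩ hmem
      exact hk k (mem_denominatorIdeal.1 hmem))
  obtain rfl := h s P hP hle
  exact Set.disjoint_left.1 hdisj hm (Submonoid.mem_powers m)

/-- In the integrally closed case, a subalgebra containing a non-scalar `u` that is a polynomial
in `u ^ 2` is everything. -/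
lemma DenominatorPrimesEq.eq_top_of_mem_adjoin_sq (h : DenominatorPrimesEq S M) (hM : M.IsPrime)
    (hR : integralClosure R S = ⊥) {T : Subalgebra R S} {u : S} (huT : u ∈ T)
    (hu : u ∉ (⊥ : Subalgebra R S)) (hsq : u ∈ Algebra.adjoin (integralClosure R S) {u ^ 2}) :
    T = ⊤ := by
  obtain ⟨⟨a, ha⟩, ⟨b, hb⟩, ⟨c, hc⟩, hac, hab⟩ :=
    IsIntegrallyClosedIn.exists_relation_of_mem_adjoin_sq hsq
  rw [hR] at ha hb hc
  obtain ⟨α, rfl⟩ := Algebra.mem_bot.1 ha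
  obtain ⟨β, rfl⟩ := Algebra.mem_bot.1 hb
  simp only [Subalgebra.algebraMap_apply] at hac hab
  have hα : α ∈ M := by
    by_contra hα
    exact hu (h.mem_of_mul_mem hα (hac ▸ hc))
  have hαβ : algebraMap R S β * u = algebraMap R S (1 - α) := by
    rw [map_sub, map_one]; linear_combination hab
  have hβ : β ∈ M := by
    by_contra hβ
    exact hu (h.mem_of_mul_mem hβ (hαβ ▸ Subalgebra.algebraMap_mem _ _))
  have hα' : 1 - α ∉ M := fun h' ↦ hM.ne_top ((Ideal.eq_top_iff_one M).2 (by
    simpa using add_mem h' hα))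
  refine eq_top_iff.2 fun s _ ↦ ?_
  obtain ⟨k, hk⟩ := h.exists_pow_mul_mem s hβ
  refine h.mem_of_mul_mem (r := (1 - α) ^ k) (fun h' ↦ hα' (hM.mem_of_pow_mem k h')) ?_
  have : algebraMap R S ((1 - α) ^ k) * s = algebraMap R S (β ^ k) * s * u ^ k := by
    rw [map_pow, ← hαβ, map_pow]; ring
  rw [this]
  exact mul_mem ((bot_le : ⊥ ≤ T) hk) (pow_mem huT k)

lemma MinimalExt.eq_or_eq {A B C : Subalgebra R S} (h : MinimalExt A B) (hA : A ≤ C)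
    (hB : C ≤ B) : C = A ∨ C = B := by
  rcases hA.eq_or_lt with heq | hlt
  · exact .inl heq.symm
  · exact .inr (hB.eq_or_lt.resolve_right (h.2 C hlt))

/-- If `R ⊂ B` is minimal, an ideal `J` of `B` satisfies `J ⊆ R` or `R + J = B`. -/
lemma MinimalExt.ideal_le_bot_or_add_eq {B : Subalgebra R S} (h : MinimalExt ⊥ B) (J : Ideal B) :
    (∀ j ∈ J, (j : S) ∈ (⊥ : Subalgebra R S)) ∨ ∀ x : B, ∃ r : R, x - algebraMap R B r ∈ J := by
  set C : Subalgebra R B := (⊥ : Subalgebra R (B ⧸ J)).comap (Ideal.Quotient.mkₐ R J) with hC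
  have hle : C.map B.val ≤ B := by
    rintro _ ⟨x, -, rfl⟩
    exact x.2
  rcases h.eq_or_eq bot_le hle with h' | h'
  · left
    intro j hj
    rw [← h']
    refine ⟨j, ?_, rfl⟩
    change Ideal.Quotient.mk J j ∈ (⊥ : Subalgebra R (B ⧸ J))
    rw [Ideal.Quotient.eq_zero_iff_mem.2 hj]
    exact zero_mem _
  · right
    intro x
    obtain ⟨y, hy, hyx⟩ : (x : S) ∈ C.map B.val := by
      rw [h']; exact x.2
    obtain rfl : y = x := Subtype.ext hyx
    obtain ⟨r, hr⟩ := Algebra.mem_bot.1 (show Ideal.Quotient.mk J y ∈ (⊥ : Subalgebra R (B ⧸ J))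
      from hy)
    exact ⟨r, Ideal.Quotient.eq.1 hr.symm⟩

lemma MinimalExt.finite {B : Subalgebra R S} (h : MinimalExt ⊥ B) (hB : B ≤ integralClosure R S) :
    Module.Finite R B := by
  obtain ⟨x, hxB, hx⟩ := SetLike.exists_of_lt h.1
  have hle : Algebra.adjoin R {x} ≤ B := Algebra.adjoin_le (by simpa using hxB)
  have hB' : Algebra.adjoin R {x} = B := (h.eq_or_eq bot_le hle).resolve_left fun h' ↦
    hx (h' ▸ Algebra.self_mem_adjoin_singleton R x)
  rw [← hB']
  exact Module.Finite.iff_fg.2 (IsIntegral.fg_adjoin_singleton (hB hxB))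

/-- If `R ⊂ B` is minimal integral, then `M B = M`. -/
lemma DenominatorPrimesEq.exists_of_mem_map (h : DenominatorPrimesEq S M) {B : Subalgebra R S}
    (hM : M ≠ ⊤) (hmin : MinimalExt ⊥ B) (hB : B ≤ integralClosure R S) {x : B}
    (hx : x ∈ M.map (algebraMap R B)) : ∃ m ∈ M, algebraMap R B m = x := by
  obtain ⟨z, hzB, hz⟩ := SetLike.exists_of_lt hmin.1
  have key : ∀ y ∈ M.map (algebraMap R B), (y : S) ∈ (⊥ : Subalgebra R S) := by
    refine (hmin.ideal_le_bot_or_add_eq _).resolve_right fun H ↦ ?_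
    have := hmin.finite hB
    obtain ⟨r, hr, hle⟩ := Submodule.exists_sub_one_mem_and_smul_le_of_fg_of_le_sup
      (I := M) (N := Subalgebra.toSubmodule (⊥ : Subalgebra R B)) (N' := ⊤) (P := ⊤)
      Module.Finite.fg_top le_top fun y _ ↦ by
        obtain ⟨r, hr⟩ := H y
        refine Submodule.mem_sup.2 ⟨algebraMap R B r, Subalgebra.algebraMap_mem _ r,
          y - algebraMap R B r, ?_, by ring⟩
        rwa [Ideal.smul_top_eq_map]
    have hrM : r ∉ M := fun h' ↦ hM ((Ideal.eq_top_iff_one M).2 (by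
      simpa using sub_mem h' hr))
    refine hz (h.mem_of_mul_mem hrM ?_)
    obtain ⟨ρ, hρ⟩ := Algebra.mem_bot.1 (hle (Submodule.smul_mem_pointwise_smul
      (⟨z, hzB⟩ : B) r ⊤ trivial))
    refine Algebra.mem_bot.2 ⟨ρ, ?_⟩
    simpa [Algebra.smul_def] using congrArg (Subtype.val) hρ
  obtain ⟨m, hm⟩ := Algebra.mem_bot.1 (key x hx)
  refine ⟨m, ?_, Subtype.ext hm⟩
  by_contra hmM
  refine hz (h.mem_of_mul_mem hmM ?_)
  rw [hm]
  exact key _ (Ideal.mul_mem_right (⟨z, hzB⟩ : B) _ hx)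

/-- `M S ⊆ T` as soon as `M B = M` and `T B = S`. -/
lemma DenominatorPrimesEq.algebraMap_mul_mem (h : DenominatorPrimesEq S M) {B T : Subalgebra R S}
    (hM : M ≠ ⊤) (hmin : MinimalExt ⊥ B) (hB : B ≤ integralClosure R S) (hsup : B ⊔ T = ⊤)
    {m : R} (hm : m ∈ M) (s : S) : algebraMap R S m * s ∈ T := by
  have hs : s ∈ Subalgebra.toSubmodule B * Subalgebra.toSubmodule T := by
    rw [Subalgebra.mul_toSubmodule, hsup]; trivial
  induction hs using Submodule.mul_induction_on' with
  | mem_mul_mem b hb t ht =>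
    obtain ⟨m', -, hm'⟩ := h.exists_of_mem_map hM hmin hB (x := algebraMap R B m * ⟨b, hb⟩)
      (Ideal.mul_mem_right _ _ (Ideal.mem_map_of_mem _ hm))
    have : algebraMap R S m' = algebraMap R S m * b := congrArg Subtype.val hm'
    rw [← mul_assoc, ← this]
    exact mul_mem (T.algebraMap_mem m') ht
  | add x _ y _ hx hy =>
    rw [mul_add]
    exact add_mem hx hy

/-- A subalgebra meeting the integral closure in `R` and generating `S` together with it
cannot exist when both steps `R ⊂ R̄ ⊂ S` are minimal. -/
lemma DenominatorPrimesEq.false_of_isCompl (h : DenominatorPrimesEq S M) (hM : M.IsPrime)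
    (h₁ : MinimalExt ⊥ (integralClosure R S)) (h₂ : MinimalExt (integralClosure R S) ⊤)
    {T : Subalgebra R S} (hT : T ≠ ⊤) (hsup : integralClosure R S ⊔ T = ⊤)
    (hinf : ∀ x ∈ integralClosure R S, x ∈ T → x ∈ (⊥ : Subalgebra R S)) : False := by
  have hMS : ∀ m ∈ M, ∀ s : S, algebraMap R S m * s ∈ T := fun m hm s ↦
    h.algebraMap_mul_mem hM.ne_top h₁ le_rfl hsup hm s
  obtain ⟨t, htT, htB⟩ : ∃ t ∈ T, t ∉ integralClosure R S := by
    by_contra! H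
    exact h₂.1.ne (by rw [← hsup, sup_eq_left.2 H])
  have ht : t ∉ (⊥ : Subalgebra R S) := fun h' ↦ htB ((bot_le : ⊥ ≤ integralClosure R S) h')
  have hsq : t ∈ Algebra.adjoin (integralClosure R S) {t ^ 2} := by
    refine Subalgebra.mem_adjoin_of_mem_sup ?_
    rcases h₂.eq_or_eq (le_sup_left : _ ≤ integralClosure R S ⊔ Algebra.adjoin R {t ^ 2}) le_top
      with h' | h'
    · have : t ^ 2 ∈ integralClosure R S :=
        sup_eq_left.1 h' (Algebra.self_mem_adjoin_singleton R _)
      exact absurd (IsIntegral.of_pow two_pos this) htB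
    · rw [h']; trivial
  obtain ⟨a, b, c, hac, hab⟩ := IsIntegrallyClosedIn.exists_relation_of_mem_adjoin_sq hsq
  simp only [Subalgebra.algebraMap_apply] at hac hab
  set J : Ideal (integralClosure R S) := Ideal.span {a, b} with hJ
  have haJ : a ∈ J := Ideal.subset_span (by simp)
  have hbJ : b ∈ J := Ideal.subset_span (by simp)
  have hJt : ∀ j ∈ J, (j : S) * t ∈ integralClosure R S := by
    intro j hj
    obtain ⟨x, y, rfl⟩ := Ideal.mem_span_pair.1 hj
    have : ((x * a + y * b : integralClosure R S) : S) * t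
        = ((x * c + y * (1 - a) : integralClosure R S) : S) := by
      push_cast
      linear_combination (x : S) * hac + (y : S) * hab
    rw [this]
    exact Subtype.property _
  have hJM : ∀ j ∈ J, ∀ r : R, algebraMap R S r = j → r ∈ M := by
    intro j hj r hr
    by_contra hrM
    refine ht (h.mem_of_mul_mem hrM (hinf _ ?_ (mul_mem (T.algebraMap_mem r) htT)))
    rw [hr]
    exact hJt j hj
  have hJ2 : ∀ j ∈ J ^ 2, (j : S) ∈ (⊥ : Subalgebra R S) := by
    refine (h₁.ideal_le_bot_or_add_eq _).elim id fun H ↦ ?_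
    obtain ⟨r, hr, hle⟩ := Submodule.exists_sub_one_mem_and_smul_le_of_fg_of_le_sup
      (I := J) (N := M.map (algebraMap R (integralClosure R S))) (N' := J) (P := J)
      (Submodule.fg_span (by simp)) le_rfl fun j hj ↦ by
        obtain ⟨ρ, hρ⟩ := H j
        have hρJ : algebraMap R (integralClosure R S) ρ ∈ J := by
          simpa using sub_mem hj (Ideal.pow_le_self two_ne_zero hρ)
        refine Submodule.mem_sup.2 ⟨_, Ideal.mem_map_of_mem _ (hJM _ hρJ ρ rfl), _, ?_,
          add_sub_cancel _ j⟩
        rwa [smul_eq_mul, ← sq]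
    have hrJ : ∀ j ∈ J, ∃ m ∈ M, algebraMap R S m = r * j := fun j hj ↦ by
      obtain ⟨m, hm, hmj⟩ := h.exists_of_mem_map hM.ne_top h₁ le_rfl
        (hle (Submodule.smul_mem_pointwise_smul j r J hj))
      exact ⟨m, hm, congrArg Subtype.val hmj⟩
    obtain ⟨m₁, hm₁, hm₁a⟩ := hrJ a haJ
    obtain ⟨m₂, hm₂, hm₂b⟩ := hrJ b hbJ
    have hrT : (r : S) ∈ T := by
      have : (r : S) = algebraMap R S m₁ * 1 + algebraMap R S m₂ * t := by
        rw [hm₁a, hm₂b]; linear_combination -(r : S) * hab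
      rw [this]
      exact add_mem (hMS _ hm₁ _) (hMS _ hm₂ _)
    obtain ⟨ρ, hρ⟩ := Algebra.mem_bot.1 (hinf _ r.2 hrT)
    have hρM : ρ ∉ M := fun h' ↦ hM.ne_top ((Ideal.eq_top_iff_one M).2 (by
      simpa using sub_mem h' (hJM _ hr (ρ - 1) (by simpa using hρ))))
    intro j hj
    refine h.mem_of_mul_mem hρM ?_
    obtain ⟨m, -, hm⟩ := hrJ j (Ideal.pow_le_self two_ne_zero hj)
    change algebraMap R S ρ = _ at hρ
    rw [hρ, ← hm]
    exact Subalgebra.algebraMap_mem _ _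
  have hJ2T : ∀ x ∈ J, ∀ y ∈ J, ∀ s : S, (x : S) * y * s ∈ T := by
    intro x hx y hy s
    have hxy : x * y ∈ J ^ 2 := by
      rw [sq]; exact Ideal.mul_mem_mul hx hy
    obtain ⟨m, hm⟩ := Algebra.mem_bot.1 (hJ2 _ hxy)
    have := hMS m (hJM _ (Ideal.pow_le_self two_ne_zero hxy) m hm) s
    rwa [show algebraMap R S m = x * y from hm] at this
  refine hT (eq_top_iff.2 fun s _ ↦ ?_)
  have : s = (a : S) * a * s + a * b * (2 * t * s) + b * b * (t ^ 2 * s) := by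
    linear_combination -s * (1 + (a + b * t)) * hab
  rw [this]
  exact add_mem (add_mem (hJ2T _ haJ _ haJ _) (hJ2T _ haJ _ hbJ _)) (hJ2T _ hbJ _ hbJ _)

lemma lengthTwo_of_card_eq_three (h : Nat.card (Subalgebra R S) = 3) : LengthTwo R S := by
  have hfin : Finite (Subalgebra R S) := Nat.finite_of_card_ne_zero (by omega)
  have := Fintype.ofFinite (Subalgebra R S)
  classical
  rw [Nat.card_eq_fintype_card] at h
  constructor
  · by_contra! H
    have hsub : (Finset.univ : Finset (Subalgebra R S)) ⊆ {⊥, ⊤} := fun T _ ↦ by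
      rcases eq_bot_or_bot_lt T with h' | h'
      · simp [h']
      · simp [not_lt_top_iff.1 (H T h')]
    have := (Finset.card_le_card hsub).trans Finset.card_le_two
    rw [Finset.card_univ] at this
    omega
  · rintro ⟨T₁, T₂, h₁, h₂, h₃⟩
    have hcard : ({⊥, T₁, T₂, ⊤} : Finset (Subalgebra R S)).card = 4 := by
      rw [Finset.card_insert_of_notMem, Finset.card_insert_of_notMem, Finset.card_pair h₃.ne]
      · simp [h₂.ne, (h₂.trans h₃).ne]
      · simp [h₁.ne, (h₁.trans h₂).ne, (h₁.trans (h₂.trans h₃)).ne]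
    have := hcard ▸ Finset.card_le_univ ({⊥, T₁, T₂, ⊤} : Finset (Subalgebra R S))
    omega

lemma LengthTwo.minimalExt {B : Subalgebra R S} (h : LengthTwo R S) (hB : ⊥ < B)
    (hB' : B < ⊤) : MinimalExt ⊥ B ∧ MinimalExt B ⊤ :=
  ⟨⟨hB, fun C h₁ h₂ ↦ h.2 ⟨C, B, h₁, h₂, hB'⟩⟩, ⟨hB', fun C h₁ h₂ ↦ h.2 ⟨B, C, hB, h₁, h₂⟩⟩⟩

lemma DenominatorPrimesEq.integralClosure_ne_bot (h : DenominatorPrimesEq S M) (hM : M.IsPrime)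
    (h2 : LengthTwo R S) : integralClosure R S ≠ ⊥ := by
  intro hR
  obtain ⟨T, hT, hT'⟩ := h2.1
  obtain ⟨t, htT, ht⟩ := SetLike.exists_of_lt hT
  have hmemF : ∀ x : S, x ∈ Algebra.adjoin R {x} := Algebra.self_mem_adjoin_singleton R
  have hF : ∀ x : S, Algebra.adjoin R {x ^ 2} ≤ Algebra.adjoin R {x} := fun x ↦
    Algebra.adjoin_le (by simpa using pow_mem (hmemF x) 2)
  have hsq : ∀ x : S, x ∉ (⊥ : Subalgebra R S) → x ^ 2 ∉ (⊥ : Subalgebra R S) := by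
    intro x hx hx2
    rw [← hR] at hx hx2
    exact hx (IsIntegral.of_pow two_pos hx2)
  have hmem : ∀ u ∈ T, u ∉ (⊥ : Subalgebra R S) → u ∉ Algebra.adjoin R {u ^ 2} :=
    fun u huT hu hu2 ↦ hT'.ne <| h.eq_top_of_mem_adjoin_sq hM hR huT hu <|
      Subalgebra.mem_adjoin_of_mem_sup
        ((le_sup_right : _ ≤ integralClosure R S ⊔ Algebra.adjoin R {u ^ 2}) hu2)
  refine h2.2 ⟨Algebra.adjoin R {(t ^ 2) ^ 2}, Algebra.adjoin R {t ^ 2}, ?_, ?_, ?_⟩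
  · exact bot_lt_iff_ne_bot.2 fun h' ↦ hsq _ (hsq t ht) (h' ▸ hmemF _)
  · exact (hF _).lt_of_ne fun h' ↦ hmem _ (pow_mem htT 2) (hsq t ht) (h' ▸ hmemF _)
  · exact lt_top_iff_ne_top.2 fun h' ↦ hmem t htT ht (h' ▸ Algebra.mem_top)

lemma DenominatorPrimesEq.eq_of_minimalExt (h : DenominatorPrimesEq S M) (hM : M.IsPrime)
    (h₁ : MinimalExt ⊥ (integralClosure R S)) (h₂ : MinimalExt (integralClosure R S) ⊤)
    (T : Subalgebra R S) : T = ⊥ ∨ T = integralClosure R S ∨ T = ⊤ := by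
  by_cases hT : T = ⊤
  · exact .inr (.inr hT)
  rcases h₁.eq_or_eq bot_le (inf_le_left : integralClosure R S ⊓ T ≤ _) with hinf | hinf
  · rcases h₂.eq_or_eq (le_sup_left : _ ≤ integralClosure R S ⊔ T) le_top with hsup | hsup
    · exact (h₁.eq_or_eq bot_le (sup_eq_left.1 hsup)).imp_right .inl
    · exact (h.false_of_isCompl hM h₁ h₂ hT hsup fun x hx hx' ↦ hinf ▸ ⟨hx, hx'⟩).elim
  · exact .inr (h₂.eq_or_eq (inf_eq_left.1 hinf) le_top)

end

theorem stmt_6 {R S : Type*} [CommRing R] [CommRing S] [Algebra R S]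
    (hinj : Function.Injective (algebraMap R S))
    (hne : (⊥ : Subalgebra R S) ≠ ⊤)
    (hnotint : ¬ Algebra.IsIntegral R S)
    (M : Ideal R) (hM : M.IsMaximal)
    (hsupp : Module.support R (S ⧸ LinearMap.range (Algebra.linearMap R S)) =
      {⟨M, hM.isPrime⟩}) :
    (LengthTwo R S ↔
        (MinimalExt ⊥ (integralClosure R S) ∧ MinimalExt (integralClosure R S) ⊤)) ∧
    (LengthTwo R S ↔ Nat.card (Subalgebra R S) = 3) ∧
    (LengthTwo R S → ∃ x : S, Algebra.adjoin R {x} = ⊤) := by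
  have h := denominatorPrimesEq_of_support hM.isPrime hsupp
  have hlt : integralClosure R S < ⊤ :=
    lt_top_iff_ne_top.2 fun h' ↦ hnotint (integralClosure_eq_top_iff.1 h')
  have h12 : LengthTwo R S →
      MinimalExt ⊥ (integralClosure R S) ∧ MinimalExt (integralClosure R S) ⊤ := fun h2 ↦
    h2.minimalExt
      (bot_lt_iff_ne_bot.2 (h.integralClosure_ne_bot hM.isPrime h2)) hlt
  have h23 : MinimalExt ⊥ (integralClosure R S) ∧ MinimalExt (integralClosure R S) ⊤ →
      Nat.card (Subalgebra R S) = 3 := fun ⟨h₁, h₂⟩ ↦ by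
    have huniv : (Set.univ : Set (Subalgebra R S)) = {⊥, integralClosure R S, ⊤} :=
      (Set.eq_univ_of_forall (h.eq_of_minimalExt hM.isPrime h₁ h₂)).symm
    rw [← Set.ncard_univ, huniv]
    exact Set.ncard_eq_three.2 ⟨_, _, _, h₁.1.ne, hne, h₂.1.ne, rfl⟩
  refine ⟨⟨h12, lengthTwo_of_card_eq_three ∘ h23⟩, ⟨h23 ∘ h12, lengthTwo_of_card_eq_three⟩,
    fun h2 ↦ ?_⟩
  obtain ⟨h₁, h₂⟩ := h12 h2
  obtain ⟨x, -, hx⟩ := SetLike.exists_of_lt hlt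
  have hxx := Algebra.self_mem_adjoin_singleton R x
  refine ⟨x, ?_⟩
  rcases h.eq_of_minimalExt hM.isPrime h₁ h₂ (Algebra.adjoin R {x}) with h' | h' | h'
  · exact absurd ((bot_le : ⊥ ≤ integralClosure R S) (h' ▸ hxx)) hx
  · exact absurd (h' ▸ hxx) hx
  · exact h'
end

section
/- Let k be a field of prime characteristic p and let L = k(y) be a finite purely inseparable simple field extension with y ∉ k. Then k ⊂ L has length 2 if and only if y^{p²} ∈ k and y^p ∉ k; and in that case the intermediate fields of k ⊆ L are exactly k, k(y^p) and L, so there are exactly 3 of them. -/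
open IntermediateField Polynomial

section PurelyInseparable

variable {k L : Type*} [Field k] [Field L] [Algebra k L] (p : ℕ)

/-- Every intermediate field of a finite purely inseparable simple extension `k(y)` is generated
by some `y ^ p ^ n`. -/
theorem IntermediateField.exists_eq_adjoin_pow_of_isPurelyInseparable [ExpChar k p]
    [FiniteDimensional k L] [IsPurelyInseparable k L] {y : L} (hy : adjoin k {y} = ⊤)
    (K : IntermediateField k L) : ∃ n : ℕ, K = adjoin k {y ^ p ^ n} := by
  have : ExpChar K p := expChar_of_injective_algebraMap (algebraMap k K).injective p
  obtain ⟨n, a, h⟩ := IsPurelyInseparable.minpoly_eq_X_pow_sub_C K p y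
  have ha : y ^ p ^ n = a := by
    have h0 := minpoly.aeval K y
    rw [h] at h0
    simpa [sub_eq_zero] using h0
  refine ⟨n, le_antisymm ?_ ?_⟩
  · conv_lhs => rw [← adjoin_minpoly_coeff_of_exists_primitive_element k hy K]
    rw [adjoin_le_iff]
    intro x hx
    obtain ⟨i, -, rfl⟩ := mem_coeffs_iff.1 hx
    have hmem : y ^ p ^ n ∈ adjoin k {y ^ p ^ n} := mem_adjoin_simple_self k _
    rw [h, ha] at *
    simp only [Polynomial.map_sub, Polynomial.map_pow, map_X, map_C, coeff_sub, coeff_X_pow,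
      coeff_C]
    refine sub_mem ?_ ?_
    · split_ifs
      exacts [one_mem _, zero_mem _]
    · split_ifs
      exacts [hmem, zero_mem _]
  · rw [adjoin_simple_le_iff, ha]
    exact a.2

/-- In a purely inseparable extension, `z` lies in `k(z ^ p)` only if it lies in `k`. -/
theorem IsPurelyInseparable.mem_bot_of_mem_adjoin_pow [ExpChar k p] (hp : 1 < p)
    [IsPurelyInseparable k L] {z : L} (hz : z ∈ adjoin k {z ^ p}) :
    z ∈ (⊥ : IntermediateField k L) := by
  obtain ⟨m, c, h⟩ := IsPurelyInseparable.minpoly_eq_X_pow_sub_C k p z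
  have h0 := minpoly.aeval k z
  rw [h] at h0
  have hc : z ^ p ^ m = algebraMap k L c := by simpa [sub_eq_zero] using h0
  rcases m with _ | m
  · exact mem_bot.2 ⟨c, by simpa using hc.symm⟩
  have hint (x : L) : IsIntegral k x := Algebra.IsIntegral.isIntegral x
  have hpos : 0 < p ^ m := pow_pos (by lia) m
  have hroot : aeval (z ^ p) (X ^ p ^ m - C c) = 0 := by
    simp [← pow_mul, ← pow_succ', hc]
  have hdeg : (minpoly k (z ^ p)).natDegree ≤ p ^ m := by
    simpa using natDegree_le_of_dvd (minpoly.dvd k _ hroot) (X_pow_sub_C_ne_zero hpos c)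
  have : FiniteDimensional k (adjoin k {z ^ p}) := adjoin.finiteDimensional (hint _)
  have hle : (minpoly k z).natDegree ≤ (minpoly k (z ^ p)).natDegree := by
    rw [← adjoin.finrank (hint z), ← adjoin.finrank (hint (z ^ p))]
    exact finrank_le_of_le_right (adjoin_simple_le_iff.2 hz)
  rw [h, natDegree_X_pow_sub_C] at hle
  exact absurd (hle.trans hdeg) (not_le.2 (Nat.pow_lt_pow_right hp m.lt_succ_self))

end PurelyInseparable


/-- The field extension `k ⊂ L` has length 2. -/
def LengthTwoF (k L : Type*) [Field k] [Field L] [Algebra k L] : Prop :=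
  (∃ K : IntermediateField k L, ⊥ < K ∧ K < ⊤) ∧
    ¬ ∃ K₁ K₂ : IntermediateField k L, ⊥ < K₁ ∧ K₁ < K₂ ∧ K₂ < ⊤

theorem stmt_7 {k L : Type*} [Field k] [Field L] [Algebra k L]
    (p : ℕ) (hp : p.Prime) (hchar : CharP k p)
    [FiniteDimensional k L] [IsPurelyInseparable k L]
    (y : L) (hy : y ∉ (⊥ : IntermediateField k L))
    (hsimple : IntermediateField.adjoin k {y} = ⊤) :
    (LengthTwoF k L ↔
      (y ^ p ^ 2 ∈ (⊥ : IntermediateField k L) ∧ y ^ p ∉ (⊥ : IntermediateField k L))) ∧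
    (LengthTwoF k L →
      (∀ K : IntermediateField k L,
        K = ⊥ ∨ K = IntermediateField.adjoin k {y ^ p} ∨ K = ⊤) ∧
      Nat.card (IntermediateField k L) = 3) := by
  have : Fact p.Prime := ⟨hp⟩
  have : ExpChar k p := ExpChar.prime hp
  have hgen := exists_eq_adjoin_pow_of_isPurelyInseparable (k := k) p hsimple
  have htop : adjoin k {y ^ p} < ⊤ := by
    refine lt_top_iff_ne_top.2 fun h => hy ?_
    exact IsPurelyInseparable.mem_bot_of_mem_adjoin_pow p hp.one_lt (h ▸ mem_top)
  have hall (h : y ^ p ^ 2 ∈ (⊥ : IntermediateField k L)) (K : IntermediateField k L) :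
      K = ⊥ ∨ K = adjoin k {y ^ p} ∨ K = ⊤ := by
    obtain ⟨n, rfl⟩ := hgen K
    rcases n with _ | _ | n
    · simp [hsimple]
    · simp
    · left
      rw [adjoin_simple_eq_bot_iff, add_assoc, add_comm, pow_add, pow_mul]
      exact pow_mem h _
  have hiff : LengthTwoF k L ↔
      (y ^ p ^ 2 ∈ (⊥ : IntermediateField k L) ∧ y ^ p ∉ (⊥ : IntermediateField k L)) := by
    constructor
    · rintro ⟨⟨K, hK, hK'⟩, hchain⟩
      have hyp : y ^ p ∉ (⊥ : IntermediateField k L) := by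
        intro h
        obtain ⟨n, rfl⟩ := hgen K
        rcases n with _ | n
        · simp [hsimple] at hK'
        · refine hK.ne' (adjoin_simple_eq_bot_iff.2 ?_)
          rw [pow_succ', pow_mul]
          exact pow_mem h _
      refine ⟨?_, hyp⟩
      by_contra h
      refine hchain ⟨adjoin k {y ^ p ^ 2}, adjoin k {y ^ p}, ?_, ?_, htop⟩
      · exact bot_lt_iff_ne_bot.2 (mt adjoin_simple_eq_bot_iff.1 h)
      · rw [sq, pow_mul]
        refine lt_of_le_not_ge
          (adjoin_simple_le_iff.2 (pow_mem (mem_adjoin_simple_self k _) p)) fun hle => hyp ?_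
        exact IsPurelyInseparable.mem_bot_of_mem_adjoin_pow p hp.one_lt
          (adjoin_simple_le_iff.1 hle)
    · rintro ⟨hyp2, hyp⟩
      refine ⟨⟨adjoin k {y ^ p}, bot_lt_iff_ne_bot.2 (mt adjoin_simple_eq_bot_iff.1 hyp), htop⟩, ?_⟩
      rintro ⟨K₁, K₂, h₁, h₁₂, h₂⟩
      have e₁ := ((hall hyp2 K₁).resolve_left h₁.ne').resolve_right (h₁₂.trans h₂).ne
      have e₂ := ((hall hyp2 K₂).resolve_left (h₁.trans h₁₂).ne').resolve_right h₂.ne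
      exact h₁₂.ne (e₁.trans e₂.symm)
  refine ⟨hiff, fun h => ?_⟩
  obtain ⟨hyp2, hyp⟩ := hiff.1 h
  have hbot : ⊥ < adjoin k {y ^ p} := bot_lt_iff_ne_bot.2 (mt adjoin_simple_eq_bot_iff.1 hyp)
  refine ⟨hall hyp2, ?_⟩
  rw [← Set.ncard_univ, Set.ncard_eq_three]
  refine ⟨⊥, adjoin k {y ^ p}, ⊤, hbot.ne, (hbot.trans htop).ne, htop.ne, ?_⟩
  exact (Set.eq_univ_of_forall (hall hyp2)).symm
end

section
/- Let k ⊆ L be a finite field extension which is neither separable nor purely inseparable, let L_s be the separable closure of k in L and let L_r be the purely inseparable closure of k in L (the relative perfect closure). Then k ⊂ L has length 2 if and only if either (1) L_r = k and the total number of intermediate fields of k ⊆ L (including k and L) is exactly 3, or (2) L_r ≠ k and this number is exactly 4. In case (1) the intermediate fields are k, L_s, L; in case (2) they are k, L_s, L_r, L; and in either case L = k(x) for some x ∈ L. -/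
open scoped Classical in
theorem Nat.card_eq_card_iff_forall_mem {α : Type*} {s : Finset α} (hs : s.Nonempty) :
    Nat.card α = s.card ↔ ∀ x, x ∈ s := by
  constructor
  · intro h x
    have : Finite α := Nat.finite_of_card_ne_zero (h ▸ hs.card_pos.ne')
    have := Fintype.ofFinite α
    rw [Finset.eq_univ_of_card s (by rw [← h, Nat.card_eq_fintype_card])]
    exact Finset.mem_univ x
  · intro h
    have e : α ≃ s := (Equiv.subtypeUnivEquiv h).symm
    rw [Nat.card_congr e, Nat.card_eq_fintype_card, Fintype.card_coe]

section

variable {k L : Type*} [Field k] [Field L] [Algebra k L]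

theorem IntermediateField.le_perfectClosure_of_inf_separableClosure_eq_bot
    [Algebra.IsAlgebraic k L] {K : IntermediateField k L}
    (h : separableClosure k L ⊓ K = ⊥) : K ≤ perfectClosure k L := by
  rw [le_perfectClosure_iff, ← separableClosure.eq_bot_iff]
  refine IntermediateField.map_injective K.val ?_
  rw [IntermediateField.map_bot, eq_bot_iff, ← h]
  refine le_inf (separableClosure.map_le_of_algHom K.val) ?_
  rintro _ ⟨x, -, rfl⟩
  exact x.2

theorem separableClosure_ne_perfectClosure (hS : separableClosure k L ≠ ⊥) :
    separableClosure k L ≠ perfectClosure k L := fun h ↦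
  hS (by simpa [← h] using separableClosure_inf_perfectClosure k L)

/-- The extension has length 2 exactly when its only intermediate fields are the two trivial ones
and the separable and purely inseparable closures. -/
theorem lengthTwoF_iff_forall [Algebra.IsAlgebraic k L] (hS : separableClosure k L ≠ ⊥)
    (hS' : separableClosure k L ≠ ⊤) (hR : perfectClosure k L ≠ ⊤) :
    LengthTwoF k L ↔ ∀ K : IntermediateField k L,
      K = ⊥ ∨ K = separableClosure k L ∨ K = perfectClosure k L ∨ K = ⊤ := by
  have hSR := separableClosure_inf_perfectClosure k L
  have hne := separableClosure_ne_perfectClosure hS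
  constructor
  · rintro ⟨-, hchain⟩ K
    have eq_of_le {A B : IntermediateField k L} (hA : A ≠ ⊥) (hB : B ≠ ⊤) (hAB : A ≤ B) :
        A = B := by
      by_contra h
      exact hchain ⟨A, B, bot_lt_iff_ne_bot.2 hA, hAB.lt_of_ne h, lt_top_iff_ne_top.2 hB⟩
    by_cases hK : K = ⊥
    · exact .inl hK
    by_cases hK' : K = ⊤
    · exact .inr (.inr (.inr hK'))
    by_cases hSK : separableClosure k L ⊓ K = ⊥
    · exact .inr (.inr (.inl (eq_of_le hK hR
        (IntermediateField.le_perfectClosure_of_inf_separableClosure_eq_bot hSK))))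
    · exact .inr (.inl ((eq_of_le hSK hK' inf_le_right).symm.trans
        (eq_of_le hSK hS' inf_le_left)))
  · refine fun h ↦ ⟨⟨_, bot_lt_iff_ne_bot.2 hS, lt_top_iff_ne_top.2 hS'⟩, ?_⟩
    rintro ⟨K₁, K₂, h₁, h₁₂, h₂⟩
    have h₁' := (h₁.trans h₁₂).ne'
    have h₂' := (h₁₂.trans h₂).ne
    rcases h K₁ with rfl | rfl | rfl | rfl
    · exact h₁.ne rfl
    · rcases h K₂ with rfl | rfl | rfl | rfl
      · exact h₁' rfl
      · exact h₁₂.ne rfl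
      · exact hS (by rwa [inf_eq_left.2 h₁₂.le] at hSR)
      · exact h₂.ne rfl
    · rcases h K₂ with rfl | rfl | rfl | rfl
      · exact h₁' rfl
      · exact h₁.ne' (by rwa [inf_eq_right.2 h₁₂.le] at hSR)
      · exact h₁₂.ne rfl
      · exact h₂.ne rfl
    · exact h₂' rfl

end

theorem stmt_8 {k L : Type*} [Field k] [Field L] [Algebra k L]
    [FiniteDimensional k L]
    (hnotsep : ¬ Algebra.IsSeparable k L)
    (hnotpi : ¬ IsPurelyInseparable k L) :
    (LengthTwoF k L ↔
      ((perfectClosure k L = ⊥ ∧ Nat.card (IntermediateField k L) = 3) ∨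
       (perfectClosure k L ≠ ⊥ ∧ Nat.card (IntermediateField k L) = 4))) ∧
    (LengthTwoF k L →
      ((perfectClosure k L = ⊥ →
          ∀ K : IntermediateField k L, K = ⊥ ∨ K = separableClosure k L ∨ K = ⊤) ∧
       (perfectClosure k L ≠ ⊥ →
          ∀ K : IntermediateField k L,
            K = ⊥ ∨ K = separableClosure k L ∨ K = perfectClosure k L ∨ K = ⊤) ∧
       (∃ x : L, IntermediateField.adjoin k {x} = ⊤))) := by
  classical
  have hS : separableClosure k L ≠ ⊥ := fun h ↦ hnotpi (separableClosure.eq_bot_iff.1 h)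
  have hS' : separableClosure k L ≠ ⊤ := fun h ↦ hnotsep ((separableClosure.eq_top_iff k L).1 h)
  have hR : perfectClosure k L ≠ ⊤ := fun h ↦
    hnotpi (isPurelyInseparable_iff_perfectClosure_eq_top.2 h)
  have hne := separableClosure_ne_perfectClosure hS
  have hbt : (⊥ : IntermediateField k L) ≠ ⊤ := fun h ↦ hS' (top_le_iff.1 (h ▸ bot_le))
  let s : Finset (IntermediateField k L) := {⊥, separableClosure k L, perfectClosure k L, ⊤}
  have hs : s.Nonempty := ⟨⊥, by simp [s]⟩
  have key : LengthTwoF k L ↔ Nat.card (IntermediateField k L) = s.card := by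
    rw [lengthTwoF_iff_forall hS hS' hR, Nat.card_eq_card_iff_forall_mem hs]
    simp [s]
  have hall := lengthTwoF_iff_forall hS hS' hR
  have hcard₃ (h : perfectClosure k L = ⊥) : s.card = 3 := by
    simp [s, h, hS, hS', hbt]
  have hcard₄ (h : perfectClosure k L ≠ ⊥) : s.card = 4 := by
    simp [s, h.symm, hS.symm, hS', hR, hne, hbt]
  refine ⟨?_, fun hlen ↦ ⟨fun h K ↦ ?_, fun _ ↦ hall.1 hlen, ?_⟩⟩
  · by_cases h : perfectClosure k L = ⊥
    · rw [key, hcard₃ h]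
      simp [h]
    · rw [key, hcard₄ h]
      simp [h]
  · have := hall.1 hlen K
    rw [h] at this
    tauto
  · have : Finite (IntermediateField k L) :=
      Nat.finite_of_card_ne_zero (key.1 hlen ▸ hs.card_pos.ne')
    exact Field.exists_primitive_element_of_finite_intermediateField k L ⊤ |>.imp
      fun x hx ↦ by simpa using hx
end

section
/- Let k ⊆ L = k(x) be a finite separable field extension with f ∈ k[X] the minimal polynomial of x over k. Let g ∈ L[X] be a monic polynomial dividing the image of f in L[X], of the form g(X) = (X − x)·g'(X) with g' irreducible over L, and let K_g be the intermediate field of k ⊆ L generated over k by the coefficients of g. If K_g ≠ L, then the extension K_g ⊂ L is minimal (there is no intermediate field strictly between K_g and L) and g is the minimal polynomial of x over K_g. -/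
open Polynomial

/-- `A ⊂ B` is a minimal extension of intermediate fields of `k ⊆ L`. -/
def MinimalExtF {k L : Type*} [Field k] [Field L] [Algebra k L]
    (A B : IntermediateField k L) : Prop :=
  A < B ∧ ∀ C : IntermediateField k L, A < C → ¬ C < B

/-- If `g = (X - x) g'` with `g'` irreducible has its coefficients in a proper intermediate
field `E` of `k ⊆ k(x)`, then `g` is the minimal polynomial of `x` over `E`. -/
theorem minpoly_map_eq_of_coeff_mem {k L : Type*} [Field k] [Field L] [Algebra k L]
    [Algebra.IsIntegral k L] {x : L} (hx : IntermediateField.adjoin k {x} = ⊤)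
    {g g' : L[X]} (hgmonic : g.Monic) (hgfact : g = (X - C x) * g') (hg'irr : Irreducible g')
    {E : IntermediateField k L} (hE : E ≠ ⊤) (hg : ∀ n, g.coeff n ∈ E) :
    (minpoly E x).map (algebraMap E L) = g := by
  have hint : IsIntegral E x := (Algebra.IsIntegral.isIntegral (R := k) x).tower_top
  have hmonic := (minpoly.monic hint).map (algebraMap E L)
  obtain ⟨p, hp⟩ : ∃ p : E[X], p.map (algebraMap E L) = g :=
    (mem_lifts _).1 <| (lifts_iff_coeff_lifts _).2 fun n => ⟨⟨_, hg n⟩, rfl⟩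
  have hdvd : (minpoly E x).map (algebraMap E L) ∣ g := by
    rw [← hp]
    refine Polynomial.map_dvd (algebraMap E L) (minpoly.dvd E x ?_)
    rw [aeval_def, eval₂_eq_eval_map, hp, hgfact]
    simp
  obtain ⟨h, hh⟩ : X - C x ∣ (minpoly E x).map (algebraMap E L) := by
    rw [dvd_iff_isRoot, IsRoot, eval_map_algebraMap, minpoly.aeval]
  rw [hh, hgfact] at hdvd
  rcases hg'irr.dvd_iff.1 ((mul_dvd_mul_iff_left (X_sub_C_ne_zero x)).1 hdvd) with hu | ha
  · refine absurd ?_ hE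
    have hdeg : (minpoly E x).degree = 1 := by
      rw [← degree_map (minpoly E x) (algebraMap E L), hh, degree_mul, degree_X_sub_C,
        degree_eq_zero_of_isUnit hu, add_zero]
    obtain ⟨y, hy⟩ := minpoly.mem_range_of_degree_eq_one E x hdeg
    rw [eq_top_iff, ← hx, IntermediateField.adjoin_simple_le_iff, ← hy]
    exact y.2
  · refine eq_of_monic_of_associated hmonic hgmonic ?_
    rw [hh, hgfact]
    exact ha.symm.mul_left _

theorem stmt_9 {k L : Type*} [Field k] [Field L] [Algebra k L]
    [FiniteDimensional k L] [Algebra.IsSeparable k L]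
    (x : L) (hx : IntermediateField.adjoin k {x} = ⊤)
    (g g' : L[X]) (hgmonic : g.Monic)
    (hgdvd : g ∣ (minpoly k x).map (algebraMap k L))
    (hgfact : g = (X - C x) * g') (hg'irr : Irreducible g')
    (hKg : IntermediateField.adjoin k (Set.range g.coeff) ≠ ⊤) :
    MinimalExtF (IntermediateField.adjoin k (Set.range g.coeff)) ⊤ ∧
    (minpoly (IntermediateField.adjoin k (Set.range g.coeff)) x).map
      (algebraMap (IntermediateField.adjoin k (Set.range g.coeff)) L) = g := by
  have hcoeff (n : ℕ) : g.coeff n ∈ IntermediateField.adjoin k (Set.range g.coeff) :=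
    IntermediateField.subset_adjoin k _ ⟨n, rfl⟩
  refine ⟨⟨hKg.lt_top, fun E hlt hE => hlt.not_ge ?_⟩,
    minpoly_map_eq_of_coeff_mem hx hgmonic hgfact hg'irr hKg hcoeff⟩
  have hmin := minpoly_map_eq_of_coeff_mem hx hgmonic hgfact hg'irr hE.ne
    fun n => hlt.le (hcoeff n)
  have hadj := IntermediateField.adjoin_minpoly_coeff_of_exists_primitive_element k hx E
  rw [hmin] at hadj
  refine hadj.ge.trans (IntermediateField.adjoin.mono _ _ _ fun c hc => ?_)
  obtain ⟨n, -, rfl⟩ := mem_coeffs_iff.1 hc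
  exact ⟨n, rfl⟩
end

section
/- Let k ⊆ L = k(x) be a finite separable field extension with k ≠ L, and let f ∈ k[X] be the minimal polynomial of x over k. If the image of f in L[X] factors as (X − x)·g with g irreducible over L (that is, f has exactly one irreducible factor over L besides X − x), then the extension k ⊂ L is minimal: there is no intermediate field strictly between k and L. -/
open Polynomial

/-- If `f = minpoly k x` factors over `L = k(x)` as `(X - x) * g` with `g` irreducible, then
`k ⊂ L` has no proper intermediate field: for such a field `K`, the minimal polynomial of `x`
over `K` lies strictly between `X - x` and `f` for divisibility. -/
theorem stmt_12 {k L : Type*} [Field k] [Field L] [Algebra k L]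
    [FiniteDimensional k L] [Algebra.IsSeparable k L]
    (hne : (⊥ : IntermediateField k L) ≠ ⊤)
    (x : L) (hx : IntermediateField.adjoin k {x} = ⊤)
    (g : L[X]) (hgirr : Irreducible g)
    (hfact : (minpoly k x).map (algebraMap k L) = (X - C x) * g) :
    ∀ K : IntermediateField k L, ⊥ < K → ¬ K < ⊤ := by
  intro K hbot htop
  have hxk : IsIntegral k x := Algebra.IsIntegral.isIntegral x
  have hxK : IsIntegral K x := hxk.tower_top
  obtain ⟨q, hq⟩ := minpoly.dvd_map_of_isScalarTower k K x
  have hroot : ((minpoly K x).map (algebraMap K L)).IsRoot x := by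
    rw [IsRoot.def, eval_map_algebraMap, minpoly.aeval]
  obtain ⟨h, hh⟩ := dvd_iff_isRoot.2 hroot
  have hg : g = h * q.map (algebraMap K L) := by
    refine mul_left_cancel₀ (X_sub_C_ne_zero x) ?_
    rw [← hfact, IsScalarTower.algebraMap_eq k K L, ← Polynomial.map_map, hq, Polynomial.map_mul,
      hh, mul_assoc]
  rcases hgirr.isUnit_or_isUnit hg with hu | hu
  · have hdeg : (minpoly K x).natDegree = 1 := by
      rw [← natDegree_map (algebraMap K L), hh, natDegree_mul (X_sub_C_ne_zero x) hu.ne_zero,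
        natDegree_X_sub_C, natDegree_eq_zero_of_isUnit hu]
    obtain ⟨y, hy⟩ := minpoly.natDegree_eq_one_iff.1 hdeg
    refine htop.not_ge ?_
    rw [← hx, IntermediateField.adjoin_simple_le_iff, ← hy]
    exact y.2
  · have hqmonic : q.Monic := (minpoly.monic hxK).of_mul_monic_left (hq ▸ (minpoly.monic hxk).map _)
    have hq1 : q = 1 := map_injective _ (algebraMap K L).injective <|
      ((hqmonic.map _).eq_one_of_isUnit hu).trans (Polynomial.map_one _).symm
    rw [hq1, mul_one] at hq
    refine hbot.not_ge ?_
    rw [← IntermediateField.adjoin_minpoly_coeff_of_exists_primitive_element k hx K,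
      IntermediateField.adjoin_le_iff, ← hq, Polynomial.map_map,
      ← IsScalarTower.algebraMap_eq k K L]
    intro y hy
    obtain ⟨n, -, rfl⟩ := mem_coeffs_iff.1 hy
    rw [coeff_map]
    exact (⊥ : IntermediateField k L).algebraMap_mem _
end

section
/- Let k ⊆ L = k(x) be a finite separable field extension of degree n with k ≠ L, f ∈ k[X] the minimal polynomial of x over k, and f = (X − x)·f₁⋯f_r the factorization of the image of f in L[X] into monic irreducible factors. Then the following are equivalent: (1) k ⊂ L is a minimal extension (no intermediate field strictly between k and L); (2) for each α ∈ {1,…,r} and each h ∈ k[X] of degree at least 1 and less than n, f_α does not divide h(X) − h(x) in L[X]; (3) for every monic g ∈ L[X] with g(x) = 0 which divides the image of f and is a strict divisor of it, the intermediate field K_g generated over k by the coefficients of g equals L. -/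
open Polynomial

open IntermediateField in
theorem exists_aeval_eq_of_adjoin_simple_eq_top {k L : Type*} [Field k] [Field L] [Algebra k L]
    [FiniteDimensional k L] {x : L} (hx : IntermediateField.adjoin k {x} = ⊤) (y : L) :
    ∃ p : k[X], aeval x p = y ∧ p.natDegree < Module.finrank k L := by
  have hint : IsIntegral k x := .of_finite k x
  have hy : y ∈ Algebra.adjoin k {x} := by
    rw [← adjoin_simple_toSubalgebra_of_isAlgebraic hint.isAlgebraic, hx]
    exact Algebra.mem_top
  rw [Algebra.adjoin_singleton_eq_range_aeval] at hy
  obtain ⟨p, rfl⟩ := hy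
  refine ⟨p %ₘ minpoly k x, by simp [aeval_modByMonic_eq_self_of_root (minpoly.aeval k x)], ?_⟩
  have hdeg := (Field.primitive_element_iff_minpoly_natDegree_eq k x).mp hx
  rw [← hdeg]
  exact natDegree_modByMonic_lt p (minpoly.monic hint) (minpoly.ne_one k x)

theorem aeval_notMem_bot_of_natDegree_lt {k L : Type*} [Field k] [Field L] [Algebra k L]
    {x : L} {h : k[X]} (h1 : 1 ≤ h.natDegree) (hlt : h.natDegree < (minpoly k x).natDegree) :
    aeval x h ∉ (⊥ : IntermediateField k L) := by
  rw [IntermediateField.mem_bot]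
  rintro ⟨c, hc⟩
  have hdeg : (h - C c).natDegree = h.natDegree := natDegree_sub_C
  have hne : h - C c ≠ 0 := by
    intro h0
    rw [h0, natDegree_zero] at hdeg
    omega
  have hdvd : minpoly k x ∣ h - C c := minpoly.dvd k x (by simp [hc])
  have := natDegree_le_of_dvd hdvd hne
  omega

theorem IntermediateField.adjoin_range_coeff_le_iff {k L : Type*} [Field k] [Field L]
    [Algebra k L] {K : IntermediateField k L} {g : L[X]} :
    IntermediateField.adjoin k (Set.range g.coeff) ≤ K ↔
      ∃ q : K[X], q.map (algebraMap K L) = g := by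
  rw [IntermediateField.adjoin_le_iff, ← mem_lifts, lifts_iff_coeff_lifts]
  simp [Set.range_subset_iff, IntermediateField.algebraMap_apply]

theorem eq_map_minpoly_of_adjoin_range_coeff_eq_bot {k L : Type*} [Field k] [Field L]
    [Algebra k L] {x : L} {g : L[X]} (hg : g.Monic) (hroot : g.eval x = 0)
    (hdvd : g ∣ (minpoly k x).map (algebraMap k L)) (hint : IsIntegral k x)
    (hbot : IntermediateField.adjoin k (Set.range g.coeff) = ⊥) :
    g = (minpoly k x).map (algebraMap k L) := by
  have hl : g ∈ lifts (algebraMap k L) := by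
    rw [lifts_iff_coeff_lifts]
    intro i
    have hi : g.coeff i ∈ IntermediateField.adjoin k (Set.range g.coeff) :=
      IntermediateField.subset_adjoin k _ (Set.mem_range_self i)
    rw [hbot] at hi
    exact IntermediateField.mem_bot.mp hi
  obtain ⟨q, rfl⟩ := (mem_lifts g).mp hl
  rw [eval_map_algebraMap] at hroot
  have hdvd' := Polynomial.map_dvd (algebraMap k L) (minpoly.dvd k x hroot)
  exact eq_of_monic_of_associated hg ((minpoly.monic hint).map _)
    (associated_of_dvd_dvd hdvd hdvd')

theorem IntermediateField.adjoin_range_coeff_map_minpoly {k L : Type*} [Field k] [Field L]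
    [Algebra k L] [FiniteDimensional k L] {x : L} (hx : IntermediateField.adjoin k {x} = ⊤)
    (K : IntermediateField k L) :
    IntermediateField.adjoin k (Set.range ((minpoly K x).map (algebraMap K L)).coeff) = K := by
  refine le_antisymm (adjoin_range_coeff_le_iff.mpr ⟨_, rfl⟩) ?_
  conv_lhs => rw [← adjoin_minpoly_coeff_of_exists_primitive_element k hx K]
  refine adjoin.mono _ _ _ fun c hc => ?_
  obtain ⟨i, -, rfl⟩ := mem_coeffs_iff.mp hc
  exact ⟨i, rfl⟩

theorem not_dvd_X_sub_C_of_separable_mul {L ι : Type*} [Field L] [Fintype ι] {x : L}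
    {f : ι → L[X]} (hsep : ((X - C x) * ∏ i, f i).Separable) {i : ι}
    (hi : ¬ IsUnit (f i)) : ¬ f i ∣ X - C x := fun hdvd =>
  hi <| hsep.isCoprime.isUnit_of_dvd' hdvd (Finset.dvd_prod_of_mem f (Finset.mem_univ i))

theorem exists_dvd_of_dvd_prod_irreducible {L ι : Type*} [Field L] [Fintype ι] {f : ι → L[X]}
    (hf : ∀ i, Irreducible (f i)) {g : L[X]} (hg : ¬ IsUnit g) (hdvd : g ∣ ∏ i, f i) :
    ∃ i, f i ∣ g := by
  have h0 : g ≠ 0 := ne_zero_of_dvd_ne_zero (Finset.prod_ne_zero_iff.mpr fun i _ => (hf i).ne_zero)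
    hdvd
  obtain ⟨p, hp, hpg⟩ := WfDvdMonoid.exists_irreducible_factor hg h0
  obtain ⟨i, -, hi⟩ := hp.prime.exists_mem_finset_dvd (hpg.trans hdvd)
  exact ⟨i, ((hp.associated_of_dvd (hf i) hi).symm.dvd).trans hpg⟩

theorem stmt_13 {k L : Type*} [Field k] [Field L] [Algebra k L]
    [FiniteDimensional k L] [Algebra.IsSeparable k L]
    (hne : (⊥ : IntermediateField k L) ≠ ⊤)
    (x : L) (hx : IntermediateField.adjoin k {x} = ⊤)
    (n : ℕ) (hn : Module.finrank k L = n)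
    (r : ℕ) (f : Fin r → L[X])
    (hfm : ∀ i, (f i).Monic) (hfi : ∀ i, Irreducible (f i))
    (hfact : (minpoly k x).map (algebraMap k L) = (X - C x) * ∏ i, f i) :
    List.TFAE
      [∀ K : IntermediateField k L, ⊥ < K → ¬ K < ⊤,
       ∀ α : Fin r, ∀ h : Polynomial k, 1 ≤ h.natDegree → h.natDegree < n →
         ¬ (f α ∣ (h.map (algebraMap k L) - C (Polynomial.aeval x h))),
       ∀ g : L[X], g.Monic → Polynomial.eval x g = 0 →
         g ∣ (minpoly k x).map (algebraMap k L) → g ≠ (minpoly k x).map (algebraMap k L) →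
         IntermediateField.adjoin k (Set.range g.coeff) = ⊤] := by
  have hint : IsIntegral k x := .of_finite k x
  have hdeg := (Field.primitive_element_iff_minpoly_natDegree_eq k x).mp hx
  tfae_have 1 → 2 := by
    intro hmin α h h1 hlt hdvd
    have hy := aeval_notMem_bot_of_natDegree_lt h1 (x := x) (L := L) (by omega)
    have htop : IntermediateField.adjoin k {aeval x h} = ⊤ := by
      by_contra hK
      refine hmin _ (bot_lt_iff_ne_bot.mpr fun hb => hy ?_) (lt_top_iff_ne_top.mpr hK)
      exact hb ▸ IntermediateField.mem_adjoin_simple_self k _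
    obtain ⟨p, hp, -⟩ := exists_aeval_eq_of_adjoin_simple_eq_top htop x
    have hfα : f α ∣ (minpoly k x).map (algebraMap k L) :=
      hfact ▸ (Finset.dvd_prod_of_mem f (Finset.mem_univ α)).mul_left _
    have hcomp : f α ∣ (p.comp h).map (algebraMap k L) - X := by
      have : minpoly k x ∣ p.comp h - X := minpoly.dvd k x (by simp [aeval_comp, hp])
      simpa using hfα.trans (Polynomial.map_dvd (algebraMap k L) this)
    have hsub : f α ∣ (p.comp h).map (algebraMap k L) - C x := by
      have := hdvd.trans (sub_dvd_eval_sub (h.map (algebraMap k L)) (C (aeval x h))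
        ((p.map (algebraMap k L)).map C))
      rw [eval_map, eval_map, ← comp, eval₂_hom, eval_map_algebraMap, hp] at this
      rwa [map_comp]
    have hsep : ((X - C x) * ∏ i, f i).Separable :=
      hfact ▸ Separable.map (Algebra.IsSeparable.isSeparable k x)
    refine not_dvd_X_sub_C_of_separable_mul hsep (hfi α).not_isUnit ?_
    simpa using dvd_sub hsub hcomp
  tfae_have 2 → 1 := by
    intro H K hbot htop
    obtain ⟨y, hyK, hy⟩ := SetLike.exists_of_lt hbot
    obtain ⟨h, rfl, hlt⟩ := exists_aeval_eq_of_adjoin_simple_eq_top hx y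
    have h1 : 1 ≤ h.natDegree := by
      by_contra! h0
      rw [eq_C_of_natDegree_eq_zero (by omega : h.natDegree = 0), aeval_C] at hy
      exact hy (algebraMap_mem _ _)
    have hgdvd : (minpoly K x).map (algebraMap K L) ∣
        h.map (algebraMap k L) - C (aeval x h) := by
      have : minpoly K x ∣ h.map (algebraMap k K) - C ⟨aeval x h, hyK⟩ :=
        minpoly.dvd K x (by simp)
      simpa [Polynomial.map_map, ← IsScalarTower.algebraMap_eq] using
        Polynomial.map_dvd (algebraMap K L) this
    have hroot : ((minpoly K x).map (algebraMap K L)).IsRoot x := by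
      rw [IsRoot, eval_map_algebraMap, minpoly.aeval]
    obtain ⟨g, hg⟩ := dvd_iff_isRoot.mpr hroot
    have hgf : g ∣ ∏ i, f i := by
      refine (mul_dvd_mul_iff_left (X_sub_C_ne_zero x)).mp ?_
      rw [← hg, ← hfact]
      simpa [Polynomial.map_map, ← IsScalarTower.algebraMap_eq] using
        Polynomial.map_dvd (algebraMap K L) (minpoly.dvd_map_of_isScalarTower k K x)
    have hgu : ¬ IsUnit g := by
      intro hu
      have hd : (minpoly K x).natDegree = 1 := by
        rw [← natDegree_map (algebraMap K L), hg, natDegree_mul (X_sub_C_ne_zero x) hu.ne_zero,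
          natDegree_X_sub_C, natDegree_eq_zero_of_isUnit hu]
      obtain ⟨z, hz⟩ := minpoly.natDegree_eq_one_iff.mp hd
      refine htop.ne (top_le_iff.mp ?_)
      rw [← hx, IntermediateField.adjoin_simple_le_iff, ← hz]
      exact z.2
    obtain ⟨α, hα⟩ := exists_dvd_of_dvd_prod_irreducible hfi hgu hgf
    exact H α h h1 (hn ▸ hlt) ((hα.trans (hg ▸ dvd_mul_left _ _)).trans hgdvd)
  tfae_have 1 → 3 := by
    intro hmin g hg hroot hdvd hgf
    by_contra hK
    exact hmin _ (bot_lt_iff_ne_bot.mpr fun hb =>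
      hgf (eq_map_minpoly_of_adjoin_range_coeff_eq_bot hg hroot hdvd hint hb))
      (lt_top_iff_ne_top.mpr hK)
  tfae_have 3 → 1 := by
    intro H K hbot htop
    have hK := IntermediateField.adjoin_range_coeff_map_minpoly hx K
    refine htop.ne (hK.symm.trans (H _ ((minpoly.monic (.of_finite K x)).map _) ?_ ?_ ?_))
    · rw [eval_map_algebraMap, minpoly.aeval]
    · simpa [Polynomial.map_map, ← IsScalarTower.algebraMap_eq] using
        Polynomial.map_dvd (algebraMap K L) (minpoly.dvd_map_of_isScalarTower k K x)
    · intro heq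
      refine hbot.not_ge (hK ▸ IntermediateField.adjoin_range_coeff_le_iff.mpr
        ⟨(minpoly k x).map (algebraMap k (⊥ : IntermediateField k L)), ?_⟩)
      rw [heq, Polynomial.map_map, ← IsScalarTower.algebraMap_eq]
  tfae_finish
end

section
/- Let k ⊆ L = k(x) be a finite separable field extension with k ≠ L, f ∈ k[X] the minimal polynomial of x over k, f = (X − x)·f₁⋯f_r its factorization into monic irreducible factors over L, and let E = {E₁,…,E_t} be the set of distinct principal subfields L_α = {h(x) : h ∈ k[X], f_α divides h(X) − h(x) in L[X]} for α = 1,…,r, with t = |E|. Then k ⊂ L has length 2 if and only if t > 1 and E_α ∩ E_β = k for all α ≠ β. Moreover, if these conditions hold, then the total number of intermediate fields of k ⊆ L (including k and L) equals t + 1 if k ∈ E and t + 2 if k ∉ E. -/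
open Polynomial

section Lattice

variable {P : Type*} [Lattice P] [BoundedOrder P] {E : Finset P}

/-- If every element of a bounded lattice is the meet of the members of `E` above it and `⊤ ∉ E`,
every element strictly between `⊥` and `⊤` lies below some member of `E`. -/
theorem exists_mem_le_of_lt_top (hE : ∀ a b : P, (∀ e ∈ E, a ≤ e → b ≤ e) → b ≤ a)
    {a : P} (ha : a < ⊤) : ∃ e ∈ E, a ≤ e := by
  by_contra! h
  exact ha.not_ge (hE a ⊤ fun e he hae ↦ absurd hae (h e he))

/-- If moreover there are no chains `⊥ < a < b < ⊤`, then all elements strictly between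
`⊥` and `⊤` belong to `E`. -/
theorem mem_of_bot_lt_of_lt_top (htop : ⊤ ∉ E)
    (hE : ∀ a b : P, (∀ e ∈ E, a ≤ e → b ≤ e) → b ≤ a)
    (hchain : ¬ ∃ a b : P, ⊥ < a ∧ a < b ∧ b < ⊤) {a : P} (hbot : ⊥ < a) (ha : a < ⊤) :
    a ∈ E := by
  obtain ⟨e, he, hae⟩ := exists_mem_le_of_lt_top hE ha
  rcases hae.eq_or_lt with rfl | hlt
  · exact he
  · exact absurd ⟨a, e, hbot, hlt, Ne.lt_top fun h ↦ htop (h ▸ he)⟩ hchain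

theorem lengthTwo_iff_of_meetDense (htop : ⊤ ∉ E)
    (hE : ∀ a b : P, (∀ e ∈ E, a ≤ e → b ≤ e) → b ≤ a) :
    ((∃ a : P, ⊥ < a ∧ a < ⊤) ∧ ¬ ∃ a b : P, ⊥ < a ∧ a < b ∧ b < ⊤) ↔
      (1 < E.card ∧ ∀ a ∈ E, ∀ b ∈ E, a ≠ b → a ⊓ b = ⊥) := by
  have hlt : ∀ e ∈ E, e < ⊤ := fun e he ↦ Ne.lt_top fun h ↦ htop (h ▸ he)
  constructor
  · rintro ⟨⟨a, hbot, ha⟩, hchain⟩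
    refine ⟨?_, fun b hb c hc hbc ↦ ?_⟩
    · have haE := mem_of_bot_lt_of_lt_top htop hE hchain hbot ha
      by_contra! hcard
      exact hbot.not_ge (hE ⊥ a fun e he _ ↦ (Finset.card_le_one.1 hcard a haE e he).le)
    · by_contra hne
      rcases (inf_le_left : b ⊓ c ≤ b).eq_or_lt with h | h
      · exact hchain ⟨b, c, (h ▸ bot_lt_iff_ne_bot.2 hne), (inf_eq_left.1 h).lt_of_ne hbc, hlt c hc⟩
      · exact hchain ⟨b ⊓ c, b, bot_lt_iff_ne_bot.2 hne, h, hlt b hb⟩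
  · rintro ⟨hcard, hinf⟩
    refine ⟨?_, ?_⟩
    · obtain ⟨a, ha, b, hb, hab⟩ := Finset.one_lt_card.1 hcard
      by_cases h : a = ⊥
      · exact ⟨b, bot_lt_iff_ne_bot.2 fun h' ↦ hab (h.trans h'.symm), hlt b hb⟩
      · exact ⟨a, bot_lt_iff_ne_bot.2 h, hlt a ha⟩
    · rintro ⟨a, b, hbot, hab, hb⟩
      obtain ⟨e, he, hbe⟩ := exists_mem_le_of_lt_top hE hb
      obtain ⟨e', he', hae', hbe'⟩ : ∃ e' ∈ E, a ≤ e' ∧ ¬ b ≤ e' := by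
        by_contra! h
        exact hab.not_ge (hE a b h)
      have hne : e ≠ e' := by rintro rfl; exact hbe' hbe
      exact hbot.not_ge ((le_inf (hab.le.trans hbe) hae').trans (hinf e he e' he' hne).le)

theorem natCard_eq_of_meetDense [Nontrivial P] (htop : ⊤ ∉ E)
    (hE : ∀ a b : P, (∀ e ∈ E, a ≤ e → b ≤ e) → b ≤ a)
    (hchain : ¬ ∃ a b : P, ⊥ < a ∧ a < b ∧ b < ⊤) :
    (⊥ ∈ E → Nat.card P = E.card + 1) ∧ (⊥ ∉ E → Nat.card P = E.card + 2) := by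
  classical
  have huniv : (Set.univ : Set P) = (insert ⊤ (insert ⊥ E) : Finset P) := by
    ext a
    simp only [Set.mem_univ, Finset.coe_insert, Set.mem_insert_iff, SetLike.mem_coe, true_iff]
    by_cases h₁ : a = ⊤
    · exact .inl h₁
    by_cases h₂ : a = ⊥
    · exact .inr (.inl h₂)
    exact .inr (.inr (mem_of_bot_lt_of_lt_top htop hE hchain
      (bot_lt_iff_ne_bot.2 h₂) (lt_top_iff_ne_top.2 h₁)))
  have hcard : Nat.card P = (insert ⊤ (insert ⊥ E) : Finset P).card := by
    rw [← Set.ncard_univ, huniv, Set.ncard_coe_finset]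
  have hnot : (⊤ : P) ∉ insert ⊥ E := by
    simp [htop, top_ne_bot]
  rw [hcard, Finset.card_insert_of_notMem hnot]
  exact ⟨fun h ↦ by rw [Finset.insert_eq_of_mem h],
    fun h ↦ by rw [Finset.card_insert_of_notMem h]⟩

end Lattice

section PrincipalSubfield

variable {k L : Type*} [Field k] [Field L] [Algebra k L]

/-- An element outside an intermediate field `K` of a separable extension is moved by some
embedding over `K` into an algebraically closed field. -/
theorem IntermediateField.exists_algHom_apply_ne_of_notMem [Algebra.IsSeparable k L]
    (Ω : Type*) [Field Ω] [Algebra k Ω] [Algebra L Ω] [IsScalarTower k L Ω] [IsAlgClosed Ω]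
    (K : IntermediateField k L) {y : L} (hy : y ∉ K) :
    ∃ σ : L →ₐ[k] Ω, (∀ z ∈ K, σ z = algebraMap L Ω z) ∧ σ y ≠ algebraMap L Ω y := by
  have : Algebra.IsSeparable K L := Algebra.isSeparable_tower_top_of_isSeparable k K L
  have hsep : (minpoly K y).Separable := Algebra.IsSeparable.isSeparable K y
  have hdeg : (minpoly K y).natDegree ≠ 1 := by
    rw [Ne, minpoly.natDegree_eq_one_iff]
    rintro ⟨z, rfl⟩
    exact hy z.2
  have hcard := card_rootSet_eq_natDegree (K := Ω) hsep (IsAlgClosed.splits _)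
  obtain ⟨w, hw, hne⟩ : ∃ w ∈ (minpoly K y).rootSet Ω, w ≠ algebraMap L Ω y := by
    by_contra! h
    have hle : Fintype.card ((minpoly K y).rootSet Ω) ≤ 1 :=
      Fintype.card_le_one_iff.2 fun a b ↦ Subtype.ext ((h a a.2).trans (h b b.2).symm)
    have hpos := minpoly.natDegree_pos (Algebra.IsIntegral.isIntegral (R := K) y)
    omega
  rw [← Algebra.IsAlgebraic.range_eval_eq_rootSet_minpoly Ω y] at hw
  obtain ⟨σ, rfl⟩ := hw
  refine ⟨σ.restrictScalars k, fun z hz ↦ ?_, hne⟩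
  exact σ.commutes ⟨z, hz⟩

/-- If `σ x` is a root of the irreducible polynomial `p` over `L`, the principal subfield attached
to `p` is the equalizer of `σ` with the structure map. -/
theorem apply_eq_algebraMap_iff_exists_dvd {Ω : Type*} [Field Ω] [Algebra k Ω] [Algebra L Ω]
    [IsScalarTower k L Ω] {x : L} (hx : Algebra.adjoin k {x} = ⊤) {p : L[X]}
    (hp : Irreducible p) (σ : L →ₐ[k] Ω) (hσ : aeval (σ x) p = 0) (y : L) :
    σ y = algebraMap L Ω y ↔
      ∃ h : k[X], aeval x h = y ∧ p ∣ h.map (algebraMap k L) - C y := by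
  have key : ∀ h : k[X], aeval x h = y →
      (p ∣ h.map (algebraMap k L) - C y ↔ σ y = algebraMap L Ω y) := by
    intro h hy
    have hdvd (q : L[X]) : p ∣ q ↔ aeval (σ x) q = 0 := by
      rw [minpoly.dvd_iff.symm, ← minpoly.eq_of_irreducible hp hσ]
      exact (Associated.dvd_iff_dvd_left (associated_mul_unit_right p _
        (isUnit_C.2 (by simpa using hp.ne_zero))))
    rw [hdvd, map_sub, aeval_map_algebraMap, aeval_C, sub_eq_zero, aeval_algHom_apply, hy]
  constructor
  · intro hy
    obtain ⟨h, rfl⟩ : ∃ h : k[X], aeval x h = y := by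
      have : y ∈ Algebra.adjoin k {x} := hx ▸ Algebra.mem_top
      rwa [Algebra.adjoin_singleton_eq_range_aeval] at this
    exact ⟨h, rfl, (key h rfl).2 hy⟩
  · rintro ⟨h, hh, hdvd⟩
    exact (key h hh).1 hdvd

end PrincipalSubfield

theorem stmt_14 {k L : Type*} [Field k] [Field L] [Algebra k L]
    [FiniteDimensional k L] [Algebra.IsSeparable k L]
    (hne : (⊥ : IntermediateField k L) ≠ ⊤)
    (x : L) (hx : IntermediateField.adjoin k {x} = ⊤)
    (r : ℕ) (f : Fin r → L[X])
    (hfm : ∀ i, (f i).Monic) (hfi : ∀ i, Irreducible (f i))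
    (hfact : (minpoly k x).map (algebraMap k L) = (X - C x) * ∏ i, f i)
    (E : Finset (IntermediateField k L))
    (hE : ∀ K : IntermediateField k L, K ∈ E ↔
      ∃ α : Fin r, (K : Set L) =
        {y : L | ∃ h : Polynomial k, Polynomial.aeval x h = y ∧
          f α ∣ (h.map (algebraMap k L) - C y)}) :
    (LengthTwoF k L ↔
      (1 < E.card ∧ ∀ A ∈ E, ∀ B ∈ E, A ≠ B → A ⊓ B = ⊥)) ∧
    (LengthTwoF k L →
      ((⊥ ∈ E → Nat.card (IntermediateField k L) = E.card + 1) ∧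
       (⊥ ∉ E → Nat.card (IntermediateField k L) = E.card + 2))) := by
  have hadj : Algebra.adjoin k {x} = ⊤ :=
    Algebra.adjoin_eq_top_of_primitive_element (Algebra.IsAlgebraic.isAlgebraic x) hx
  have hsep : ((minpoly k x).map (algebraMap k L)).Separable :=
    Separable.map (Algebra.IsSeparable.isSeparable k x)
  have hfdvd : ∀ α, f α ∣ (minpoly k x).map (algebraMap k L) := fun α ↦
    hfact ▸ (Finset.dvd_prod_of_mem f (Finset.mem_univ α)).mul_left _
  have htop : ⊤ ∉ E := by
    intro h
    obtain ⟨α, hα⟩ := (hE ⊤).1 h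
    obtain ⟨p, hp, hdvd⟩ : x ∈ {y : L | ∃ h : Polynomial k, aeval x h = y ∧
        f α ∣ (h.map (algebraMap k L) - C y)} := hα ▸ IntermediateField.mem_top
    have hmin : minpoly k x ∣ p - X := minpoly.dvd k x (by simp [hp])
    have hdvd' : f α ∣ X - C x := by
      have := dvd_sub hdvd ((hfdvd α).trans (Polynomial.map_dvd (algebraMap k L) hmin))
      simpa using this
    have hassoc := (hfi α).associated_of_dvd (irreducible_X_sub_C x) hdvd'
    have hsq : (X - C x) * (X - C x) ∣ (minpoly k x).map (algebraMap k L) :=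
      hfact ▸ mul_dvd_mul_left _
        (hassoc.symm.dvd.trans (Finset.dvd_prod_of_mem f (Finset.mem_univ α)))
    exact not_isUnit_X_sub_C x (hsep.squarefree _ hsq)
  have hdense : ∀ A B : IntermediateField k L, (∀ K ∈ E, A ≤ K → B ≤ K) → B ≤ A := by
    intro A B hAB y hyB
    by_contra hyA
    obtain ⟨σ, hσA, hσy⟩ := A.exists_algHom_apply_ne_of_notMem (AlgebraicClosure L) hyA
    have hroot : aeval (σ x) ((X - C x) * ∏ i, f i) = 0 := by
      rw [← hfact, aeval_map_algebraMap, aeval_algHom_apply, minpoly.aeval, map_zero]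
    rw [map_mul, mul_eq_zero, map_prod, Finset.prod_eq_zero_iff] at hroot
    rcases hroot with h | ⟨α, -, hα⟩
    · have hσ : σ = IsScalarTower.toAlgHom k L (AlgebraicClosure L) :=
        AlgHom.ext_of_adjoin_eq_top hadj (by
          rintro _ rfl
          simpa [sub_eq_zero] using h)
      exact hσy (by simp [hσ])
    · have hiff := apply_eq_algebraMap_iff_exists_dvd hadj (hfi α) σ hα
      let K : IntermediateField k L :=
        (AlgHom.equalizer σ (IsScalarTower.toAlgHom k L (AlgebraicClosure L))).toIntermediateField
          fun z hz ↦ by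
            rw [AlgHom.mem_equalizer] at hz ⊢
            rw [map_inv₀, map_inv₀, hz]
      have hK : K ∈ E := (hE K).2 ⟨α, Set.ext hiff⟩
      exact hσy (hAB K hK hσA hyB)
  have : Nontrivial (IntermediateField k L) := ⟨⟨⊥, ⊤, hne⟩⟩
  exact ⟨lengthTwo_iff_of_meetDense htop hdense,
    fun h ↦ natCard_eq_of_meetDense htop hdense h.2⟩
end

section
/- Let k ⊆ L be a finite Galois field extension of degree n which has length 2. Then the total number of intermediate fields of k ⊆ L (including k and L) is at most n + 1. -/
/-- If a finite group has no chain `⊥ < H₁ < H₂ < ⊤` of subgroups, then it has at most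
`|G| + 1` subgroups: distinct proper nontrivial subgroups share no nonidentity element. -/
theorem Subgroup.card_le_of_no_chain {G : Type*} [Group G] [Finite G]
    (h : ∀ H₁ H₂ : Subgroup G, ⊥ < H₁ → H₁ < H₂ → ¬ H₂ < ⊤) :
    Nat.card (Subgroup G) ≤ Nat.card G + 1 := by
  classical
  have hex : ∀ H : Subgroup G, ∃ g ∈ H, g = 1 → H = ⊥ := fun H ↦ by
    by_cases hH : H = ⊥
    · exact ⟨1, H.one_mem, fun _ ↦ hH⟩
    · obtain ⟨g, hg, hg1⟩ := H.bot_or_exists_ne_one.resolve_left hH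
      exact ⟨g, hg, fun h1 ↦ absurd h1 hg1⟩
  choose g hg hg1 using hex
  have hle : ∀ H K : Subgroup G, H ≠ ⊤ → g H = g K → H ≤ K := fun H K hH hHK ↦ by
    by_cases h1 : g H = 1
    · simp [hg1 H h1]
    · by_contra hnle
      refine h (H ⊓ K) H (bot_lt_iff_ne_bot.2 fun hbot ↦ h1 ?_) (inf_lt_left.2 hnle)
        (lt_top_iff_ne_top.2 hH)
      rw [← Subgroup.mem_bot, ← hbot]
      exact ⟨hg H, hHK ▸ hg K⟩
  rw [← Finite.card_option]
  refine Nat.card_le_card_of_injective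
    (fun H : Subgroup G ↦ if H = ⊤ then none else some (g H)) fun H K hHK ↦ ?_
  by_cases hH : H = ⊤ <;> by_cases hK : K = ⊤ <;> simp [hH, hK] at hHK ⊢
  exact le_antisymm (hle H K hH hHK) (hle K H hK hHK.symm)

theorem stmt_16 {k L : Type*} [Field k] [Field L] [Algebra k L]
    [IsGalois k L] [FiniteDimensional k L]
    (n : ℕ) (hn : Module.finrank k L = n)
    (hlen : LengthTwoF k L) :
    Nat.card (IntermediateField k L) ≤ n + 1 := by
  let e := IsGalois.intermediateFieldEquivSubgroup (F := k) (E := L)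
  rw [← hn, ← IsGalois.card_aut_eq_finrank k L,
    Nat.card_congr (e.toEquiv.trans OrderDual.ofDual)]
  refine Subgroup.card_le_of_no_chain fun H₁ H₂ h₁ h₁₂ h₂ ↦ hlen.2
    ⟨e.symm (OrderDual.toDual H₂), e.symm (OrderDual.toDual H₁), ?_, ?_, ?_⟩
  · rw [← e.symm.map_bot]
    exact e.symm.strictMono h₂
  · exact e.symm.strictMono h₁₂
  · rw [← e.symm.map_top]
    exact e.symm.strictMono h₁
end

section
/- Let R ⊂ S be a ring extension of length 2 which is simple, i.e., S = R[x] for some x ∈ S, where R[x] is the R-subalgebra of S generated by x. Then R ⊂ S has FIP: there are only finitely many R-subalgebras of S. -/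
namespace Subalgebra

open Polynomial

section CommRing

variable {R S : Type*} [CommRing R] [CommRing S] [Algebra R S]

/-- The subalgebra `R + N` for a multiplicatively closed submodule `N`. -/
def scalarsAdd (N : Submodule R S) (h : ∀ x ∈ N, ∀ y ∈ N, x * y ∈ N) : Subalgebra R S :=
  (1 ⊔ N).toSubalgebra (Submodule.mem_sup_left (Submodule.one_le.1 le_rfl)) <| by
    intro x y hx hy
    obtain ⟨_, ⟨r, rfl⟩, u, hu, rfl⟩ := Submodule.mem_sup.1 hx
    obtain ⟨_, ⟨r', rfl⟩, u', hu', rfl⟩ := Submodule.mem_sup.1 hy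
    refine Submodule.mem_sup.2 ⟨_, ⟨r * r', rfl⟩, r • u' + r' • u + u * u',
      add_mem (add_mem (N.smul_mem _ hu') (N.smul_mem _ hu)) (h _ hu _ hu'), ?_⟩
    simp [Algebra.smul_def]
    ring

theorem mem_scalarsAdd {N : Submodule R S} {h : ∀ x ∈ N, ∀ y ∈ N, x * y ∈ N} {s : S} :
    s ∈ scalarsAdd N h ↔ ∃ r : R, ∃ u ∈ N, algebraMap R S r + u = s := by
  simp [scalarsAdd, Submodule.mem_toSubalgebra, Submodule.mem_sup]

/-- The subalgebra `R + bB` for an element `b` of a subalgebra `B`. -/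
def scalarsAddMul (B : Subalgebra R S) (b : S) (hb : b ∈ B) : Subalgebra R S :=
  scalarsAdd (B.toSubmodule.map (LinearMap.mulLeft R b)) <| by
    rintro _ ⟨u, hu, rfl⟩ _ ⟨v, hv, rfl⟩
    exact ⟨u * (b * v), B.mul_mem hu (B.mul_mem hb hv), by simp [mul_assoc]⟩

theorem mem_scalarsAddMul {B : Subalgebra R S} {b : S} {hb : b ∈ B} {s : S} :
    s ∈ scalarsAddMul B b hb ↔ ∃ r : R, ∃ u ∈ B, algebraMap R S r + b * u = s := by
  simp [scalarsAddMul, mem_scalarsAdd]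

theorem scalarsAddMul_le {B : Subalgebra R S} {b : S} (hb : b ∈ B) :
    scalarsAddMul B b hb ≤ B := by
  intro s hs
  obtain ⟨r, u, hu, rfl⟩ := mem_scalarsAddMul.1 hs
  exact B.add_mem (B.algebraMap_mem r) (B.mul_mem hb hu)

/-- If `R` is integrally closed in `S` and `p(t) = 0`, then every non-constant coefficient of `p`
lies in `(R : t) + (R : t)t`. -/
theorem exists_coeff_eq_add_mul (hcl : ∀ s : S, IsIntegral R s → s ∈ (⊥ : Subalgebra R S)) {t : S}
    (n : ℕ) (p : R[X]) (hn : p.natDegree ≤ n) (hp : aeval t p = 0) (k : ℕ) (hk : k ≠ 0) :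
    ∃ i j : R, algebraMap R S i * t ∈ (⊥ : Subalgebra R S) ∧
      algebraMap R S j * t ∈ (⊥ : Subalgebra R S) ∧
      algebraMap R S (p.coeff k) = algebraMap R S i + algebraMap R S j * t := by
  induction n generalizing p with
  | zero =>
    refine ⟨0, 0, by simp, by simp, ?_⟩
    rw [coeff_eq_zero_of_natDegree_lt (by lia)]
    simp
  | succ n ih =>
    rcases hn.lt_or_eq with hlt | heq
    · exact ih p (by lia) hp
    have hmem := hcl _ (isIntegral_leadingCoeff_smul p t hp)
    set a := p.leadingCoeff with ha
    rw [Algebra.smul_def] at hmem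
    obtain ⟨r, hr⟩ := Algebra.mem_bot.1 hmem
    have hcoeff : ∀ m, (p - C a * X ^ (n + 1) + C r * X ^ n).coeff m =
        p.coeff m - (if m = n + 1 then a else 0) + (if m = n then r else 0) := by
      intro m
      simp [coeff_X_pow]
    obtain ⟨i, j, hi, hj, h⟩ := ih (p - C a * X ^ (n + 1) + C r * X ^ n) (by
      refine natDegree_le_iff_coeff_eq_zero.2 fun m hm => ?_
      rw [hcoeff, if_neg (by lia : ¬ m = n)]
      split_ifs with hm'
      · simp [hm', ha, leadingCoeff, heq]
      · rw [coeff_eq_zero_of_natDegree_lt (by lia)]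
        simp) (by
      simp only [map_add, map_sub, map_mul, aeval_C, map_pow, aeval_X, hp, hr]
      ring)
    rw [hcoeff] at h
    by_cases h1 : k = n + 1
    · refine ⟨a, 0, hmem, by simp, ?_⟩
      simp [h1, ha, leadingCoeff, heq]
    · rw [if_neg h1, sub_zero] at h
      by_cases h2 : k = n
      · refine ⟨i, j - a, hi, ?_, ?_⟩
        · rw [map_sub, sub_mul]
          exact sub_mem hj hmem
        · rw [if_pos h2, map_add] at h
          rw [map_sub]
          linear_combination h - hr
      · exact ⟨i, j, hi, hj, by simpa [h2] using h⟩

/-- The subalgebra `R + I` for an ideal `I` of `S`. -/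
def scalarsAddIdeal (I : Ideal S) : Subalgebra R S :=
  scalarsAdd (I.restrictScalars R) fun x _ _ hy => I.mul_mem_left x hy

theorem mem_scalarsAddIdeal {I : Ideal S} {s : S} :
    s ∈ (scalarsAddIdeal I : Subalgebra R S) ↔
      ∃ r : R, ∃ u ∈ I, algebraMap R S r + u = s :=
  mem_scalarsAdd

theorem mem_scalarsAddIdeal_of_mem {I : Ideal S} {s : S} (hs : s ∈ I) :
    s ∈ (scalarsAddIdeal I : Subalgebra R S) :=
  mem_scalarsAddIdeal.2 ⟨0, s, hs, by simp⟩

variable (R S) in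
/-- There is no chain of four `R`-subalgebras of `S` from the bottom to the top. -/
def NoLongChain : Prop :=
  ¬ ∃ T₁ T₂ : Subalgebra R S, ⊥ < T₁ ∧ T₁ < T₂ ∧ T₂ < ⊤

namespace NoLongChain

theorem eq_of_le (hc : NoLongChain R S) {T U : Subalgebra R S} (hT : T ≠ ⊥) (hU : U ≠ ⊤)
    (h : T ≤ U) : T = U := by
  by_contra hne
  exact hc ⟨T, U, bot_lt_iff_ne_bot.2 hT, lt_of_le_of_ne h hne, lt_top_iff_ne_top.2 hU⟩

theorem sup_eq_top (hc : NoLongChain R S) {T U : Subalgebra R S} (hT : T ≠ ⊥) (hU : U ≠ ⊥)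
    (hne : T ≠ U) : T ⊔ U = ⊤ := by
  by_contra h
  exact hne ((hc.eq_of_le hT h le_sup_left).trans (hc.eq_of_le hU h le_sup_right).symm)

theorem inf_eq_bot (hc : NoLongChain R S) {T U : Subalgebra R S} (hT : T ≠ ⊤) (hU : U ≠ ⊤)
    (hne : T ≠ U) : T ⊓ U = ⊥ := by
  by_contra h
  exact hne ((hc.eq_of_le h hT inf_le_left).symm.trans (hc.eq_of_le h hU inf_le_right))

theorem mem_bot_of_mem (hc : NoLongChain R S) {T U : Subalgebra R S} (hT : T ≠ ⊤) (hU : U ≠ ⊤)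
    (hne : T ≠ U) {s : S} (h₁ : s ∈ T) (h₂ : s ∈ U) : s ∈ (⊥ : Subalgebra R S) :=
  hc.inf_eq_bot hT hU hne ▸ ⟨h₁, h₂⟩

theorem mul_mem_of_forall (hc : NoLongChain R S) {T U : Subalgebra R S} (hT : T ≠ ⊥) (hU : U ≠ ⊥)
    (hne : T ≠ U) {a : S} (ha : ∀ t ∈ T, a * t ∈ (⊥ : Subalgebra R S)) (s : S) : a * s ∈ U := by
  have hs : s ∈ Subalgebra.toSubmodule T * Subalgebra.toSubmodule U := by
    rw [Subalgebra.mul_toSubmodule, hc.sup_eq_top hT hU hne]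
    trivial
  induction hs using Submodule.mul_induction_on' with
  | mem_mul_mem t ht u hu =>
    rw [← mul_assoc]
    exact U.mul_mem ((bot_le : ⊥ ≤ U) (ha t ht)) hu
  | add x _ y _ hx hy =>
    rw [mul_add]
    exact U.add_mem hx hy

section Infinite

variable [Infinite (Subalgebra R S)]

theorem exists_third (T U : Subalgebra R S) :
    ∃ V : Subalgebra R S, V ≠ ⊥ ∧ V ≠ ⊤ ∧ V ≠ T ∧ V ≠ U := by
  classical
  obtain ⟨V, hV⟩ := Infinite.exists_notMem_finset ({⊥, ⊤, T, U} : Finset (Subalgebra R S))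
  exact ⟨V, by simpa using hV⟩

/-- All proper subalgebras other than `R` have the same conductor over `R`. -/
theorem mul_mem_bot (hc : NoLongChain R S) {T : Subalgebra R S} (hT : T ≠ ⊥) {a : R}
    (ha : ∀ t ∈ T, algebraMap R S a * t ∈ (⊥ : Subalgebra R S)) (s : S) :
    algebraMap R S a * s ∈ (⊥ : Subalgebra R S) := by
  by_cases hT' : T = ⊤
  · exact ha s (hT' ▸ trivial)
  obtain ⟨U, hU, hU', hUT, -⟩ := exists_third T T
  obtain ⟨V, hV, hV', hVT, hVU⟩ := exists_third T U
  by_cases h : ∀ u ∈ U, algebraMap R S a * u ∈ (⊥ : Subalgebra R S)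
  · exact hc.mem_bot_of_mem hT' hU' hUT.symm (hc.mul_mem_of_forall hU hT hUT h s)
      (hc.mul_mem_of_forall hT hU hUT.symm ha s)
  · push Not at h
    obtain ⟨u, hu, hau⟩ := h
    have hB := scalarsAddMul_le (U.algebraMap_mem a)
    have hB' : scalarsAddMul U _ (U.algebraMap_mem a) ≠ ⊥ := by
      intro hbot
      exact hau (hbot ▸ mem_scalarsAddMul.2 ⟨0, u, hu, by simp⟩)
    have hUV : U ≤ V := by
      rw [← hc.eq_of_le hB' hU' hB]
      intro s hs
      obtain ⟨r, w, -, rfl⟩ := mem_scalarsAddMul.1 hs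
      exact V.add_mem (V.algebraMap_mem r) (hc.mul_mem_of_forall hT hV hVT.symm ha w)
    exact absurd (hc.eq_of_le hU hV' hUV).symm hVU

theorem exists_eq_add_mul (hc : NoLongChain R S) {B : Subalgebra R S} (hB : B ≠ ⊥) {a : R}
    (ha : ¬ ∀ s, algebraMap R S a * s ∈ (⊥ : Subalgebra R S)) {t : S} (ht : t ∈ B) :
    ∃ r : R, ∃ u ∈ B, algebraMap R S r + algebraMap R S a * u = t := by
  have key : ∀ C : Subalgebra R S, C ≠ ⊥ → scalarsAddMul C _ (C.algebraMap_mem a) ≠ ⊥ :=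
    fun C hC hbot => ha <| hc.mul_mem_bot hC fun u hu =>
      hbot ▸ mem_scalarsAddMul.2 ⟨0, u, hu, by simp⟩
  have proper : ∀ C : Subalgebra R S, C ≠ ⊥ → C ≠ ⊤ → scalarsAddMul C _ (C.algebraMap_mem a) = C :=
    fun C hC hC' => hc.eq_of_le (key C hC) hC' (scalarsAddMul_le _)
  suffices h : scalarsAddMul B _ (B.algebraMap_mem a) = B from mem_scalarsAddMul.1 (h.symm ▸ ht)
  by_cases hB' : B = ⊤
  · subst hB'
    by_contra hne
    have hle : ∀ C : Subalgebra R S, C ≠ ⊥ → C ≠ ⊤ →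
        C = scalarsAddMul ⊤ _ ((⊤ : Subalgebra R S).algebraMap_mem a) := by
      refine fun C hC hC' => hc.eq_of_le hC hne fun c hc' => ?_
      rw [← proper C hC hC'] at hc'
      obtain ⟨r, u, -, rfl⟩ := mem_scalarsAddMul.1 hc'
      exact mem_scalarsAddMul.2 ⟨r, u, trivial, rfl⟩
    obtain ⟨U, hU, hU', -⟩ := exists_third (⊤ : Subalgebra R S) ⊤
    obtain ⟨V, hV, hV', -, hVU⟩ := exists_third (⊤ : Subalgebra R S) U
    exact hVU ((hle V hV hV').trans (hle U hU hU').symm)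
  · exact proper B hB hB'

/-- If `P = (R : S)` is not maximal, then `R` is integrally closed in `S`. -/
theorem mem_bot_of_isIntegral (hc : NoLongChain R S) {P : Ideal R}
    (hP : ∀ a, a ∈ P ↔ ∀ s, algebraMap R S a * s ∈ (⊥ : Subalgebra R S))
    {J : Ideal R} (hPJ : P < J) (hJ : J ≠ ⊤) {s : S} (hs : IsIntegral R s) :
    s ∈ (⊥ : Subalgebra R S) := by
  by_contra hs'
  obtain ⟨a, haJ, haP⟩ := SetLike.exists_of_lt hPJ
  have hB : Algebra.adjoin R {s} ≠ ⊥ := fun h => hs' (h ▸ Algebra.self_mem_adjoin_singleton R s)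
  obtain ⟨r, hr, hrB⟩ := Submodule.exists_sub_one_mem_and_smul_le_of_fg_of_le_sup
    (I := Ideal.span {a}) (N := Subalgebra.toSubmodule (⊥ : Subalgebra R S))
    (P := Subalgebra.toSubmodule (Algebra.adjoin R {s})) hs.fg_adjoin_singleton le_rfl (by
      intro t ht
      obtain ⟨r, u, hu, rfl⟩ := hc.exists_eq_add_mul hB (fun h => haP ((hP a).2 h)) ht
      refine Submodule.add_mem_sup ((⊥ : Subalgebra R S).algebraMap_mem r) ?_
      rw [← Algebra.smul_def]
      exact Submodule.smul_mem_smul (Ideal.mem_span_singleton_self a) hu)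
  have hrP : r ∈ P := (hP r).2 <| hc.mul_mem_bot hB fun t ht => by
    rw [← Algebra.smul_def]
    exact hrB (Submodule.smul_mem_pointwise_smul t r _ ht)
  refine hJ ((Ideal.eq_top_iff_one J).2 ?_)
  have h1 : r - 1 ∈ J := (Ideal.span_singleton_le_iff_mem J).2 haJ hr
  simpa using J.sub_mem (hPJ.le hrP) h1

end Infinite

/-- If `R` is integrally closed in `S`, then every element `t` of a proper subalgebra satisfies
`(R : t) + (R : t)t = R`. -/
theorem exists_add_mul_eq_one (hc : NoLongChain R S)
    (hcl : ∀ s : S, IsIntegral R s → s ∈ (⊥ : Subalgebra R S))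
    {T : Subalgebra R S} (hT' : T ≠ ⊤) {t : S} (ht : t ∈ T) :
    ∃ i ∈ (⊥ : Subalgebra R S), ∃ j ∈ (⊥ : Subalgebra R S), i * t ∈ (⊥ : Subalgebra R S) ∧
      j * t ∈ (⊥ : Subalgebra R S) ∧ i + j * t = 1 := by
  by_cases htb : t ∈ (⊥ : Subalgebra R S)
  · exact ⟨1, one_mem _, 0, zero_mem _, by simpa, by simp, by simp⟩
  have hsq : Algebra.adjoin R {t ^ 2} ≠ ⊥ := by
    intro h
    have h2 : t ^ 2 ∈ (⊥ : Subalgebra R S) := h ▸ Algebra.self_mem_adjoin_singleton R _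
    obtain ⟨r, hr⟩ := Algebra.mem_bot.1 h2
    exact htb (hcl t (IsIntegral.of_pow two_pos (hr ▸ isIntegral_algebraMap)))
  have hle : Algebra.adjoin R {t ^ 2} ≤ T :=
    Algebra.adjoin_le (Set.singleton_subset_iff.2 (T.pow_mem ht 2))
  rw [← hc.eq_of_le hsq hT' hle, Algebra.adjoin_singleton_eq_range_aeval] at ht
  obtain ⟨f, hf⟩ := ht
  obtain ⟨i, j, hi, hj, h⟩ := exists_coeff_eq_add_mul hcl (t := t) _ (X - expand R 2 f) le_rfl
    (by simpa [expand_aeval, sub_eq_zero] using hf.symm) 1 one_ne_zero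
  refine ⟨_, (⊥ : Subalgebra R S).algebraMap_mem i, _, (⊥ : Subalgebra R S).algebraMap_mem j,
    hi, hj, ?_⟩
  rw [← h]
  simp [coeff_expand]

theorem exists_add_eq_one (hc : NoLongChain R S)
    (hcl : ∀ s : S, IsIntegral R s → s ∈ (⊥ : Subalgebra R S))
    {T U : Subalgebra R S} (hT : T ≠ ⊤) (hU : U ≠ ⊤) (hne : T ≠ U) {t u : S}
    (ht : t ∈ T) (hu : u ∈ U) :
    ∃ a ∈ (⊥ : Subalgebra R S), ∃ b ∈ (⊥ : Subalgebra R S), a + b = 1 ∧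
      a * t ∈ (⊥ : Subalgebra R S) ∧ b * u ∈ (⊥ : Subalgebra R S) := by
  have hbT : (⊥ : Subalgebra R S) ≤ T := bot_le
  have hbU : (⊥ : Subalgebra R S) ≤ U := bot_le
  obtain ⟨i, hi, k, hk, hit, hkt, h1⟩ := hc.exists_add_mul_eq_one hcl hT ht
  obtain ⟨i', hi', k', hk', hiw, hkw, h2⟩ :=
    hc.exists_add_mul_eq_one hcl hU (U.mul_mem (hbU hk) hu)
  refine ⟨i + k * t * (k' * (k * u)), add_mem hi (mul_mem hkt hkw), k * t * i',
    mul_mem hkt hi', by linear_combination h1 + k * t * h2, ?_,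
    hc.mem_bot_of_mem hT hU hne ?_ ?_⟩
  · have h3 : k' * (k * u) * t ∈ (⊥ : Subalgebra R S) := by
      refine hc.mem_bot_of_mem hT hU hne (T.mul_mem (hbT hkw) ht) ?_
      rw [show k' * (k * u) * t = k' * (k * t) * u by ring]
      exact U.mul_mem (hbU (mul_mem hk' hkt)) hu
    rw [show (i + k * t * (k' * (k * u))) * t = i * t + k * t * (k' * (k * u) * t) by ring]
    exact add_mem hit (mul_mem hkt h3)
  · rw [show k * t * i' * u = i' * (k * u) * t by ring]
    exact T.mul_mem (hbT hiw) ht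
  · exact U.mul_mem (hbU (mul_mem hkt hi')) hu

/-- The elements `s` with `(R : s) + (R : t) = R`. -/
def comaximalSubalgebra (t : S) : Subalgebra R S where
  carrier := {s | ∃ a ∈ (⊥ : Subalgebra R S), ∃ b ∈ (⊥ : Subalgebra R S), a + b = 1 ∧
    a * s ∈ (⊥ : Subalgebra R S) ∧ b * t ∈ (⊥ : Subalgebra R S)}
  mul_mem' := by
    rintro s s' ⟨a, ha, b, hb, h, has, hbt⟩ ⟨a', ha', b', hb', h', has', hbt'⟩
    refine ⟨a * a', mul_mem ha ha', b + a * b', add_mem hb (mul_mem ha hb'),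
      by linear_combination h + a * h', ?_, ?_⟩
    · rw [mul_mul_mul_comm]
      exact mul_mem has has'
    · rw [add_mul, mul_assoc]
      exact add_mem hbt (mul_mem ha hbt')
  add_mem' := by
    rintro s s' ⟨a, ha, b, hb, h, has, hbt⟩ ⟨a', ha', b', hb', h', has', hbt'⟩
    refine ⟨a * a', mul_mem ha ha', b + a * b', add_mem hb (mul_mem ha hb'),
      by linear_combination h + a * h', ?_, ?_⟩
    · rw [show a * a' * (s + s') = a' * (a * s) + a * (a' * s') by ring]
      exact add_mem (mul_mem ha' has) (mul_mem ha has')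
    · rw [add_mul, mul_assoc]
      exact add_mem hbt (mul_mem ha hbt')
  algebraMap_mem' r := ⟨1, one_mem _, 0, zero_mem _, by simp,
    by rw [one_mul]; exact (⊥ : Subalgebra R S).algebraMap_mem r, by simp⟩

theorem isMaximal_conductor (hc : NoLongChain R S) [Infinite (Subalgebra R S)] {P : Ideal R}
    (hP : ∀ a, a ∈ P ↔ ∀ s, algebraMap R S a * s ∈ (⊥ : Subalgebra R S)) : P.IsMaximal := by
  obtain ⟨T, hT, hT', -⟩ := exists_third (⊤ : Subalgebra R S) ⊤
  refine Ideal.isMaximal_def.2 ⟨fun h => hT (eq_bot_iff.2 fun t _ => ?_), fun J hPJ => ?_⟩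
  · simpa using (hP 1).1 (h ▸ trivial) t
  · by_contra hJ
    have hcl : ∀ s : S, IsIntegral R s → s ∈ (⊥ : Subalgebra R S) :=
      fun s => hc.mem_bot_of_isIntegral hP hPJ hJ
    obtain ⟨U, hU, hU', hUT, -⟩ := exists_third T T
    obtain ⟨V, hV, hV', hVT, hVU⟩ := exists_third T U
    refine hV (eq_bot_iff.2 fun v hv => ?_)
    have hle : T ⊔ U ≤ comaximalSubalgebra v :=
      sup_le (fun t ht => hc.exists_add_eq_one hcl hT' hV' hVT.symm ht hv)
        (fun u hu => hc.exists_add_eq_one hcl hU' hV' hVU.symm hu hv)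
    rw [hc.sup_eq_top hT hU hUT.symm] at hle
    obtain ⟨a, -, b, -, h, hav, hbv⟩ := hle (show v ∈ ⊤ from trivial)
    rw [← one_mul v, ← h, add_mul]
    exact add_mem hav hbv

end NoLongChain

end CommRing

section Field

variable {k A : Type*} [Field k] [CommRing A] [Algebra k A]

theorem _root_.finite_ideal_of_adjoin_eq_top {x : A} (hx : Algebra.adjoin k {x} = ⊤)
    (hint : IsAlgebraic k x) : Finite (Ideal A) := by
  have hsurj : Function.Surjective (aeval x : k[X] →ₐ[k] A) := by
    rw [← AlgHom.range_eq_top, ← Algebra.adjoin_singleton_eq_range_aeval, hx]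
  obtain ⟨p, hp0, hp⟩ := hint
  have hspan : Ideal.span {p} ≠ 0 := by simpa using hp0
  have := UniqueFactorizationMonoid.fintypeSubtypeDvd (Ideal.span {p}) hspan
  refine Finite.of_injective (β := {J : Ideal k[X] // J ∣ Ideal.span {p}})
    (fun I => ⟨I.comap (aeval x : k[X] →ₐ[k] A), ?_⟩) fun I I' h => ?_
  · rw [Ideal.dvd_iff_le, Ideal.span_singleton_le_iff_mem, Ideal.mem_comap, hp]
    exact I.zero_mem
  · exact Ideal.comap_injective_of_surjective _ hsurj (Subtype.ext_iff.1 h)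

theorem eq_zero_of_algebraMap_mem {I : Ideal A} (hI : I ≠ ⊤) {c : k} (hc : algebraMap k A c ∈ I) :
    c = 0 := by
  by_contra h
  exact hI (I.eq_top_of_isUnit_mem hc ((IsUnit.mk0 c h).map _))

theorem scalarsAddIdeal_ne_bot {I : Ideal A} (hI : I ≠ ⊤) (hI' : I ≠ ⊥) :
    (scalarsAddIdeal I : Subalgebra k A) ≠ ⊥ := by
  obtain ⟨y, hy, hy0⟩ := Submodule.exists_mem_ne_zero_of_ne_bot hI'
  intro h
  obtain ⟨c, rfl⟩ := Algebra.mem_bot.1 (h ▸ mem_scalarsAddIdeal_of_mem (R := k) hy)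
  exact hy0 (by rw [eq_zero_of_algebraMap_mem hI hy, map_zero])

theorem isUnit_sub_algebraMap {T : Subalgebra k A} (hT : ∀ t ∈ T, t ≠ 0 → IsUnit t) {t : A}
    (ht : t ∈ T) (htb : t ∉ (⊥ : Subalgebra k A)) (c : k) : IsUnit (t - algebraMap k A c) :=
  hT _ (T.sub_mem ht (T.algebraMap_mem c)) fun h => htb (sub_eq_zero.1 h ▸ ⟨c, rfl⟩)

/-- If `A` contains a field `T` other than `k`, then `k + I ≠ A` for every proper ideal `I`. -/
theorem scalarsAddIdeal_ne_top {T : Subalgebra k A} (hT : ∀ t ∈ T, t ≠ 0 → IsUnit t)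
    (hT' : T ≠ ⊥) {I : Ideal A} (hI : I ≠ ⊤) : (scalarsAddIdeal I : Subalgebra k A) ≠ ⊤ := by
  intro h
  refine hT' (eq_bot_iff.2 fun t ht => ?_)
  by_contra htb
  obtain ⟨c, u, hu, rfl⟩ := mem_scalarsAddIdeal.1 (h.symm ▸ trivial : t ∈ scalarsAddIdeal (R := k) I)
  have := isUnit_sub_algebraMap hT ht htb c
  exact hI (I.eq_top_of_isUnit_mem hu (by simpa using this))

theorem adjoin_singleton_le_scalarsAddIdeal (y : A) :
    Algebra.adjoin k {y} ≤ scalarsAddIdeal (Ideal.span {y}) :=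
  Algebra.adjoin_le <| Set.singleton_subset_iff.2 <|
    mem_scalarsAddIdeal_of_mem (Ideal.mem_span_singleton_self y)

theorem exists_eq_add_mul_of_mem_adjoin {y : A} {c : k} (hy : y * y = algebraMap k A c * y) {s : A}
    (hs : s ∈ Algebra.adjoin k {y}) :
    ∃ a b : k, s = algebraMap k A a + algebraMap k A b * y := by
  induction hs using Algebra.adjoin_induction with
  | mem s hs =>
    obtain rfl := hs
    exact ⟨0, 1, by simp⟩
  | algebraMap r => exact ⟨r, 0, by simp⟩
  | add s s' _ _ h h' =>
    obtain ⟨a, b, rfl⟩ := h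
    obtain ⟨a', b', rfl⟩ := h'
    exact ⟨a + a', b + b', by simp only [map_add]; ring⟩
  | mul s s' _ _ h h' =>
    obtain ⟨a, b, rfl⟩ := h
    obtain ⟨a', b', rfl⟩ := h'
    refine ⟨a * a', a * b' + b * a' + b * b' * c, ?_⟩
    simp only [map_add, map_mul]
    linear_combination algebraMap k A b * algebraMap k A b' * hy

namespace NoLongChain

theorem scalarsAddIdeal_eq_of_le (hc : NoLongChain k A) {T : Subalgebra k A}
    (hT : ∀ t ∈ T, t ≠ 0 → IsUnit t) (hT' : T ≠ ⊥) {y z : A} (hz : z ≠ 0) (hy : ¬ IsUnit y)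
    (hyz : y ∣ z) :
    (scalarsAddIdeal (Ideal.span {z}) : Subalgebra k A) = scalarsAddIdeal (Ideal.span {y}) := by
  have hle : Ideal.span {z} ≤ Ideal.span {y} := Ideal.span_singleton_le_span_singleton.2 hyz
  have hytop : Ideal.span {y} ≠ ⊤ := fun h => hy (Ideal.span_singleton_eq_top.1 h)
  refine hc.eq_of_le (scalarsAddIdeal_ne_bot (ne_top_of_le_ne_top hytop hle) ?_)
    (scalarsAddIdeal_ne_top hT hT' hytop) fun s hs => ?_
  · rwa [Ne, Ideal.span_singleton_eq_bot]
  · obtain ⟨c, u, hu, rfl⟩ := mem_scalarsAddIdeal.1 hs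
    exact mem_scalarsAddIdeal.2 ⟨c, u, hle hu, rfl⟩

theorem eq_zero_of_mul_self (hc : NoLongChain k A) {T : Subalgebra k A}
    (hT : ∀ t ∈ T, t ≠ 0 → IsUnit t) (hT' : T ≠ ⊥) {y : A} (hy : ¬ IsUnit y) {c : k}
    (hyc : y * y = algebraMap k A c * y) : y = 0 := by
  by_contra hy0
  obtain ⟨t, ht, htb⟩ := SetLike.exists_of_lt (bot_lt_iff_ne_bot.2 hT')
  have hytop : Ideal.span {y} ≠ ⊤ := fun h => hy (Ideal.span_singleton_eq_top.1 h)
  have hadj : Algebra.adjoin k {y} = scalarsAddIdeal (Ideal.span {y}) := by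
    refine hc.eq_of_le (fun h => hy0 ?_) (scalarsAddIdeal_ne_top hT hT' hytop)
      (adjoin_singleton_le_scalarsAddIdeal y)
    obtain ⟨a, ha⟩ := Algebra.mem_bot.1 (h ▸ Algebra.self_mem_adjoin_singleton k y)
    have := eq_zero_of_algebraMap_mem (c := a) hytop
      (by rw [ha]; exact Ideal.mem_span_singleton_self y)
    rw [← ha, this, map_zero]
  have hmem : t * y ∈ Ideal.span {y} := Ideal.mul_mem_left _ t (Ideal.mem_span_singleton_self y)
  obtain ⟨a, b, hab⟩ := exists_eq_add_mul_of_mem_adjoin hyc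
    (hadj ▸ mem_scalarsAddIdeal_of_mem hmem)
  have ha : a = 0 := by
    refine eq_zero_of_algebraMap_mem hytop ?_
    rw [eq_sub_of_add_eq hab.symm]
    exact Ideal.sub_mem _ hmem (Ideal.mul_mem_left _ _ (Ideal.mem_span_singleton_self y))
  refine hy0 ((isUnit_sub_algebraMap hT ht htb b).mul_right_eq_zero.1 ?_)
  rw [sub_mul, hab, ha]
  simp

/-- If some proper subalgebra other than `k` is a field, then so is the whole algebra. -/
theorem isUnit_of_subalgebra (hc : NoLongChain k A) {T : Subalgebra k A}
    (hT : ∀ t ∈ T, t ≠ 0 → IsUnit t) (hT' : T ≠ ⊥) {y : A} (hy0 : y ≠ 0) : IsUnit y := by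
  by_contra hy
  have hytop : Ideal.span {y} ≠ ⊤ := fun h => hy (Ideal.span_singleton_eq_top.1 h)
  by_cases hyy : y * y = 0
  · exact hy0 (hc.eq_zero_of_mul_self hT hT' hy (c := 0) (by simpa))
  have hmem : y ∈ (scalarsAddIdeal (Ideal.span {y * y}) : Subalgebra k A) := by
    rw [hc.scalarsAddIdeal_eq_of_le hT hT' hyy hy (dvd_mul_right y y)]
    exact mem_scalarsAddIdeal_of_mem (Ideal.mem_span_singleton_self y)
  obtain ⟨a, u, hu, hau⟩ := mem_scalarsAddIdeal.1 hmem
  obtain ⟨b, rfl⟩ := Ideal.mem_span_singleton'.1 hu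
  have ha : a = 0 := by
    refine eq_zero_of_algebraMap_mem hytop (Ideal.mem_span_singleton'.2 ⟨1 - b * y, ?_⟩)
    linear_combination -hau
  rw [ha, map_zero, zero_add] at hau
  have he : y * b = 0 := by
    refine hc.eq_zero_of_mul_self hT hT' (fun h => hy (isUnit_of_mul_isUnit_left h)) (c := 1) ?_
    rw [map_one]
    linear_combination b * hau
  exact hy0 (by linear_combination -hau + y * he)

theorem isAlgebraic (hc : NoLongChain k A) (x : A) : IsAlgebraic k x := by
  have hle : Algebra.adjoin k {x ^ 4} ≤ Algebra.adjoin k {x ^ 2} := by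
    refine Algebra.adjoin_le (Set.singleton_subset_iff.2 ?_)
    rw [show x ^ 4 = (x ^ 2) ^ 2 by ring]
    exact pow_mem (Algebra.self_mem_adjoin_singleton k _) 2
  by_cases h4 : Algebra.adjoin k {x ^ 4} = ⊥
  · obtain ⟨c, hc'⟩ := Algebra.mem_bot.1 (h4 ▸ Algebra.self_mem_adjoin_singleton k (x ^ 4))
    exact IsAlgebraic.of_pow (n := 4) (by norm_num) (hc' ▸ isAlgebraic_algebraMap c)
  by_cases h2 : Algebra.adjoin k {x ^ 2} = ⊤
  · obtain ⟨f, hf⟩ : x ∈ (aeval (x ^ 2) : k[X] →ₐ[k] A).range := by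
      rw [← Algebra.adjoin_singleton_eq_range_aeval, h2]
      trivial
    refine ⟨X - expand k 2 f, fun h => ?_, by simpa [expand_aeval, sub_eq_zero] using hf.symm⟩
    simpa [coeff_expand] using congrArg (coeff · 1) h
  · have h := hc.eq_of_le h4 h2 hle
    obtain ⟨f, hf⟩ : x ^ 2 ∈ (aeval (x ^ 4) : k[X] →ₐ[k] A).range := by
      rw [← Algebra.adjoin_singleton_eq_range_aeval, h]
      exact Algebra.self_mem_adjoin_singleton k _
    refine ⟨X ^ 2 - expand k 4 f, fun h => ?_, by simpa [expand_aeval, sub_eq_zero] using hf.symm⟩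
    simpa [coeff_expand] using congrArg (coeff · 2) h

theorem isUnit_of_forall_ideal (hc : NoLongChain k A) [Module.Finite k A] {T : Subalgebra k A}
    (hT : T ≠ ⊥) (hI : ∀ I : Ideal A, (∀ s ∈ I, s ∈ T) → I = ⊥) :
    ∀ t ∈ T, t ≠ 0 → IsUnit t := by
  intro t ht ht0
  have : Module.Finite T A := Module.Finite.of_restrictScalars_finite k T A
  let U : Subalgebra T A := scalarsAddIdeal (Ideal.span {t})
  have hTU : T ≤ U.restrictScalars k := fun s hs => U.algebraMap_mem ⟨s, hs⟩
  have hU : U.restrictScalars k = ⊤ := by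
    by_contra hne
    refine ht0 (Ideal.span_singleton_eq_bot.1 (hI (Ideal.span {t}) fun s hs => ?_))
    rw [hc.eq_of_le hT hne hTU]
    exact mem_scalarsAddIdeal_of_mem (R := T) hs
  obtain ⟨r, hr, hrT⟩ := Submodule.exists_sub_one_mem_and_smul_le_of_fg_of_le_sup
    (I := Ideal.span {(⟨t, ht⟩ : T)}) (N := Subalgebra.toSubmodule (⊥ : Subalgebra T A))
    (P := ⊤) Module.Finite.fg_top le_rfl (by
      intro s _
      have hs : s ∈ U.restrictScalars k := hU ▸ trivial
      obtain ⟨τ, u, hu, rfl⟩ := mem_scalarsAddIdeal.1 hs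
      obtain ⟨v, rfl⟩ := Ideal.mem_span_singleton'.1 hu
      refine Submodule.add_mem_sup ((⊥ : Subalgebra T A).algebraMap_mem τ) ?_
      rw [mul_comm]
      exact Submodule.smul_mem_smul (Ideal.mem_span_singleton_self (⟨t, ht⟩ : T))
        (Submodule.mem_top (x := v)))
  have hr0 : r = 0 := by
    refine Subtype.ext (Ideal.span_singleton_eq_bot.1 (hI (Ideal.span {(r : A)}) fun s hs => ?_))
    obtain ⟨v, rfl⟩ := Ideal.mem_span_singleton'.1 hs
    obtain ⟨τ, hτ⟩ := Algebra.mem_bot.1 (hrT (Submodule.smul_mem_pointwise_smul v r _ trivial))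
    rw [mul_comm]
    exact (show (τ : A) = r * v from hτ) ▸ τ.2
  obtain ⟨v, hv⟩ := Ideal.mem_span_singleton'.1 hr
  refine IsUnit.of_mul_eq_one (-v : A) ?_
  have := congrArg (Subtype.val : T → A) hv
  simp only [hr0, MulMemClass.coe_mul, zero_sub, NegMemClass.coe_neg, OneMemClass.coe_one] at this
  linear_combination -this

theorem finite_of_field (hc : NoLongChain k A) {x : A} (hx : Algebra.adjoin k {x} = ⊤) :
    Finite (Subalgebra k A) := by
  have hfin : Module.Finite k A := by
    refine Module.finite_def.2 ?_
    have := (hc.isAlgebraic x).isIntegral.fg_adjoin_singleton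
    rwa [hx, Algebra.top_toSubmodule] at this
  have := finite_ideal_of_adjoin_eq_top hx (hc.isAlgebraic x)
  by_cases hA : IsField A
  · let := hA.toField
    have := Field.finite_intermediateField_of_exists_primitive_element k A
      ⟨x, IntermediateField.toSubalgebra_injective (top_le_iff.1
        (hx ▸ IntermediateField.algebra_adjoin_le_adjoin k {x}))⟩
    exact Finite.of_equiv _ (subalgebraEquivIntermediateField (K := k) (L := A)).symm.toEquiv
  · refine Finite.of_surjective (scalarsAddIdeal : Ideal A → Subalgebra k A) fun T => ?_
    by_cases hT : T = ⊥
    · refine ⟨⊥, hT ▸ eq_bot_iff.2 fun s hs => ?_⟩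
      obtain ⟨c, u, hu, rfl⟩ := mem_scalarsAddIdeal.1 hs
      obtain rfl := hu
      exact ⟨c, by simp⟩
    by_cases hT' : T = ⊤
    · exact ⟨⊤, hT' ▸ eq_top_iff.2 fun s _ => mem_scalarsAddIdeal_of_mem trivial⟩
    by_contra! hne
    have hI : ∀ I : Ideal A, (∀ s ∈ I, s ∈ T) → I = ⊥ := by
      intro I hIT
      by_contra hI0
      have hItop : I ≠ ⊤ := by
        rintro rfl
        exact hT' (eq_top_iff.2 fun s _ => hIT s trivial)
      refine hne I (hc.eq_of_le (scalarsAddIdeal_ne_bot hItop hI0) hT' fun s hs => ?_)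
      obtain ⟨c, u, hu, rfl⟩ := mem_scalarsAddIdeal.1 hs
      exact T.add_mem (T.algebraMap_mem c) (hIT u hu)
    have : Nontrivial A := by
      by_contra hn
      have := not_nontrivial_iff_subsingleton.1 hn
      exact hT (Subsingleton.elim _ _)
    exact hA ⟨exists_pair_ne A, mul_comm, fun hy0 => (hc.isUnit_of_subalgebra
      (hc.isUnit_of_forall_ideal hT hI) hT hy0).exists_right_inv⟩

end NoLongChain

end Field

end Subalgebra

theorem stmt_18 {R S : Type*} [CommRing R] [CommRing S] [Algebra R S]
    (hinj : Function.Injective (algebraMap R S))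
    (hne : (⊥ : Subalgebra R S) ≠ ⊤)
    (hlen : LengthTwo R S)
    (hsimple : ∃ x : S, Algebra.adjoin R {x} = ⊤) :
    Finite (Subalgebra R S) := by
  by_contra hinf
  rw [not_finite_iff_infinite] at hinf
  obtain ⟨x, hx⟩ := hsimple
  have hnlc : Subalgebra.NoLongChain R S := hlen.2
  let P : Ideal R := (Subalgebra.toSubmodule (⊥ : Subalgebra R S)).colon (⊤ : Set S)
  have hP : ∀ a, a ∈ P ↔ ∀ s, algebraMap R S a * s ∈ (⊥ : Subalgebra R S) := by
    intro a
    simp [P, Submodule.mem_colon, Algebra.smul_def]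
  have hmax := hnlc.isMaximal_conductor hP
  let := Ideal.Quotient.field P
  let I : Ideal S := P.map (algebraMap R S)
  have hI : ∀ s ∈ I, s ∈ (⊥ : Subalgebra R S) := by
    intro s hs
    suffices h : ∀ u, s * u ∈ (⊥ : Subalgebra R S) by simpa using h 1
    refine Submodule.span_induction ?_ (by simp) (fun _ _ _ _ h h' u => ?_)
      (fun v s _ h u => ?_) hs
    · rintro _ ⟨a, ha, rfl⟩
      exact (hP a).1 ha
    · rw [add_mul]
      exact add_mem (h u) (h' u)
    · rw [smul_eq_mul, mul_comm v, mul_assoc]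
      exact h (v * u)
  let φ : S →ₐ[R] S ⧸ I := Ideal.Quotient.mkₐ R I
  have hφ : Function.Surjective φ := Ideal.Quotient.mk_surjective
  let G : Subalgebra (R ⧸ P) (S ⧸ I) → Subalgebra R S := fun T => (T.restrictScalars R).comap φ
  have hG : StrictMono G := by
    refine Monotone.strictMono_of_injective (fun T U h s hs => h hs) fun T U h => ?_
    ext y
    obtain ⟨s, rfl⟩ := hφ y
    exact SetLike.ext_iff.1 h s
  have hGs : Function.Surjective G := by
    intro T
    refine ⟨{ (T.map φ).toSubsemiring with algebraMap_mem' := ?_ }, ?_⟩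
    · intro r
      obtain ⟨r, rfl⟩ := Ideal.Quotient.mk_surjective r
      exact ⟨algebraMap R S r, T.algebraMap_mem r, rfl⟩
    · ext s
      refine ⟨?_, fun hs => ⟨s, hs, rfl⟩⟩
      rintro ⟨t, ht, hts⟩
      have h := (bot_le : ⊥ ≤ T) (hI _ (Ideal.Quotient.eq.1 hts))
      simpa using sub_mem (show t ∈ T from ht) h
  have hc : Subalgebra.NoLongChain (R ⧸ P) (S ⧸ I) := by
    rintro ⟨T₁, T₂, h₀, h₁, h₂⟩
    exact hnlc ⟨G T₁, G T₂, bot_le.trans_lt (hG h₀), hG h₁, (hG h₂).trans_le le_top⟩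
  have hxφ : Algebra.adjoin (R ⧸ P) {φ x} = ⊤ := by
    refine eq_top_iff.2 fun y _ => ?_
    obtain ⟨s, rfl⟩ := hφ y
    have hle : Algebra.adjoin R {x} ≤ G (Algebra.adjoin (R ⧸ P) {φ x}) :=
      Algebra.adjoin_le (Set.singleton_subset_iff.2 (Algebra.self_mem_adjoin_singleton _ (φ x)))
    exact hle (hx ▸ trivial)
  have := hc.finite_of_field hxφ
  have := Finite.of_surjective G hGs
  exact not_finite (Subalgebra R S)
end

section
/- Let R be an integral domain which is integrally closed (in its field of fractions) and is not a field, and let R ⊂ S be an integral ring extension admitting a finite maximal chain of R-subalgebras R = R₀ ⊊ R₁ ⊊ ⋯ ⊊ Rₙ = S (n ≥ 1) in which each step Rᵢ ⊂ Rᵢ₊₁ is a minimal extension. Then S is not an integral domain. In particular, this holds when R ⊂ S is an integral extension of length 2. -/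
open Polynomial in
/-- Over an integrally closed domain, an integral element of an extension domain satisfying a
polynomial whose reduction modulo some maximal ideal is nonzero of degree at most one lies in
the base ring. -/
lemma mem_bot_of_aeval_eq_zero_of_natDegree_map_le_one {R S K : Type*} [CommRing R] [IsDomain R]
    [IsIntegrallyClosed R] [CommRing S] [IsDomain S] [Algebra R S] [Module.IsTorsionFree R S]
    [CommRing K] [IsDomain K] (f : R →+* K) {t : S} (ht : IsIntegral R t) {p : R[X]}
    (hp : aeval t p = 0) (hp0 : p.map f ≠ 0) (hdeg : (p.map f).natDegree ≤ 1) :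
    t ∈ (⊥ : Subalgebra R S) := by
  have hle := natDegree_le_of_dvd
    (Polynomial.map_dvd f (minpoly.isIntegrallyClosed_dvd ht hp)) hp0
  rw [(minpoly.monic ht).natDegree_map] at hle
  exact Algebra.mem_bot.mpr
    ((minpoly.natDegree_eq_one_iff).mp (le_antisymm (hle.trans hdeg) (minpoly.natDegree_pos ht)))

open Polynomial in
/-- An integrally closed domain which is not a field has no minimal integral extension inside a
domain. -/
lemma not_minimalExt_bot {R S : Type*} [CommRing R] [IsDomain R] [IsIntegrallyClosed R]
    [CommRing S] [IsDomain S] [Algebra R S] (hinj : Function.Injective (algebraMap R S))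
    (hnf : ¬ IsField R) [Algebra.IsIntegral R S] (T : Subalgebra R S) :
    ¬ MinimalExt ⊥ T := by
  rintro ⟨hlt, hmin⟩
  have : FaithfulSMul R S := (faithfulSMul_iff_algebraMap_injective R S).mpr hinj
  obtain ⟨t, htT, ht⟩ := SetLike.exists_of_lt hlt
  have hti : IsIntegral R t := Algebra.IsIntegral.isIntegral t
  obtain ⟨m, hm⟩ := Ideal.exists_maximal R
  obtain ⟨r, hrm, hr⟩ := Submodule.exists_mem_ne_zero_of_ne_bot
    (Ring.ne_bot_of_isMaximal_of_not_isField hm hnf)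
  have hle : Algebra.adjoin R {r • t} ≤ T :=
    Algebra.adjoin_le (Set.singleton_subset_iff.mpr (T.smul_mem htT r))
  have hbot : ⊥ < Algebra.adjoin R {r • t} := by
    refine bot_lt_iff_ne_bot.mpr fun h => ht ?_
    have hmem : r • t ∈ (⊥ : Subalgebra R S) := h ▸ Algebra.self_mem_adjoin_singleton R (r • t)
    obtain ⟨s, hs⟩ := Algebra.mem_bot.mp hmem
    have hdeg : natDegree (C r * X + C (-s)) = 1 := natDegree_linear hr
    refine mem_bot_of_aeval_eq_zero_of_natDegree_map_le_one (RingHom.id R) hti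
      (p := C r * X + C (-s)) ?_ ?_ ?_
    · simp [hs, Algebra.smul_def]
    · rw [Polynomial.map_id]
      exact ne_zero_of_natDegree_gt (n := 0) (by omega)
    · rw [Polynomial.map_id, hdeg]
  have heq : Algebra.adjoin R {r • t} = T :=
    hle.eq_of_not_lt (hmin _ hbot)
  rw [← heq, Algebra.adjoin_singleton_eq_range_aeval] at htT
  obtain ⟨p, hp⟩ := htT
  have hp : aeval (r • t) p = t := hp
  have hmap : (X - p.comp (C r * X)).map (Ideal.Quotient.mk m) =
      X - C (Ideal.Quotient.mk m (p.coeff 0)) := by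
    simp [Polynomial.map_comp, Ideal.Quotient.eq_zero_iff_mem.mpr hrm, coeff_zero_eq_eval_zero]
  refine ht (mem_bot_of_aeval_eq_zero_of_natDegree_map_le_one (Ideal.Quotient.mk m) hti
    (p := X - p.comp (C r * X)) ?_ ?_ ?_)
  · rw [map_sub, aeval_comp, aeval_X, map_mul, aeval_X, aeval_C, ← Algebra.smul_def, hp, sub_self]
  · rw [hmap]
    exact X_sub_C_ne_zero _
  · rw [hmap, natDegree_X_sub_C]

theorem stmt_19 {R S : Type*} [CommRing R] [IsDomain R] [IsIntegrallyClosed R]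
    [CommRing S] [Algebra R S]
    (hinj : Function.Injective (algebraMap R S))
    (hne : (⊥ : Subalgebra R S) ≠ ⊤)
    (hnf : ¬ IsField R)
    (hint : Algebra.IsIntegral R S) :
    ((∃ n : ℕ, 1 ≤ n ∧ ∃ c : Fin (n + 1) → Subalgebra R S,
        c 0 = ⊥ ∧ c (Fin.last n) = ⊤ ∧
        ∀ i : Fin n, MinimalExt (c i.castSucc) (c i.succ)) →
      ¬ IsDomain S) ∧
    (LengthTwo R S → ¬ IsDomain S) := by
  refine ⟨?_, ?_⟩
  · rintro ⟨n, hn, c, hc0, -, hc⟩ _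
    obtain ⟨k, rfl⟩ := Nat.exists_eq_add_of_le' hn
    have h := hc 0
    rw [Fin.castSucc_zero, hc0] at h
    exact not_minimalExt_bot hinj hnf _ h
  · rintro ⟨⟨T, hT, hT'⟩, hlen⟩ _
    exact not_minimalExt_bot hinj hnf T ⟨hT, fun C hC hCT => hlen ⟨C, T, hC, hCT, hT'⟩⟩
end
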